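/- arXiv:1907.01524 — 3 statements merged into one kernel-verified Lean document; each statement's English description precedes it below -/
import Mathlib

section
/- Let χ₁, χ₂ be primitive Dirichlet characters of conductors q₁, q₂ respectively, with q₁, q₂ > 1 and χ₁(−1)χ₂(−1) = 1. For γ ∈ Γ₀(q₁q₂) with bottom-right entry d(γ), define φ(γ) = f_{χ₁,χ₂}(γ·i) − ψ(d(γ))·f_{χ₁,χ₂}(i), where ψ = χ₁·conj(χ₂) and i is the imaginary unit. Then for all γ₁, γ₂ ∈ Γ₀(q₁q₂), φ(γ₁γ₂) = φ(γ₁) + ψ(d(γ₁))·φ(γ₂). -/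
open Complex

/-- `e(w) = exp(2πiw)`. -/
noncomputable def eC (w : ℂ) : ℂ := Complex.exp (2 * Real.pi * Complex.I * w)

/-- The holomorphic part `f_{χ₁,χ₂}(z) = ∑_{l≥1} ∑_{k≥1} (χ₁(l) conj(χ₂)(k) / l) e(klz)`. -/
noncomputable def fE {q₁ q₂ : ℕ} (χ₁ : DirichletCharacter ℂ q₁)
    (χ₂ : DirichletCharacter ℂ q₂) (z : ℂ) : ℂ :=
  ∑' l : ℕ+, ∑' k : ℕ+,
    χ₁ ((l : ℕ) : ZMod q₁) * (starRingEnd ℂ) (χ₂ ((k : ℕ) : ZMod q₂)) / (l : ℂ)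
      * eC ((k : ℂ) * (l : ℂ) * z)

/-- The Gauss sum `τ(χ) = ∑_{n mod q} χ(n) e(n/q)`. -/
noncomputable def gaussSum' {q : ℕ} (χ : DirichletCharacter ℂ q) : ℂ :=
  ∑ n ∈ Finset.range q, χ ((n : ℕ) : ZMod q) * eC ((n : ℂ) / (q : ℂ))

/-- The first Bernoulli function, `B₁(x) = x - ⌊x⌋ - 1/2` off ℤ, and `0` on ℤ. -/
noncomputable def B1 (x : ℝ) : ℝ := if Int.fract x = 0 then 0 else Int.fract x - 1 / 2

/-- The Möbius action of an integer matrix `(a b; c d)` on `ℂ`: `z ↦ (az+b)/(cz+d)`. -/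
noncomputable def moebius (γ : Matrix.SpecialLinearGroup (Fin 2) ℤ) (z : ℂ) : ℂ :=
  (((γ : Matrix (Fin 2) (Fin 2) ℤ) 0 0 : ℂ) * z + ((γ : Matrix (Fin 2) (Fin 2) ℤ) 0 1 : ℂ)) /
    (((γ : Matrix (Fin 2) (Fin 2) ℤ) 1 0 : ℂ) * z + ((γ : Matrix (Fin 2) (Fin 2) ℤ) 1 1 : ℂ))

/-- `ψ(d) = (χ₁ · conj(χ₂))(d)` evaluated at an integer `d`. -/
noncomputable def psi {q₁ q₂ : ℕ} (χ₁ : DirichletCharacter ℂ q₁)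
    (χ₂ : DirichletCharacter ℂ q₂) (d : ℤ) : ℂ :=
  χ₁ (d : ZMod q₁) * (starRingEnd ℂ) (χ₂ (d : ZMod q₂))

/-- `φ(γ) = f_{χ₁,χ₂}(γ·i) − ψ(d(γ))·f_{χ₁,χ₂}(i)`. -/
noncomputable def phi {q₁ q₂ : ℕ} (χ₁ : DirichletCharacter ℂ q₁)
    (χ₂ : DirichletCharacter ℂ q₂) (γ : Matrix.SpecialLinearGroup (Fin 2) ℤ) : ℂ :=
  fE χ₁ χ₂ (moebius γ Complex.I) -
    psi χ₁ χ₂ ((γ : Matrix (Fin 2) (Fin 2) ℤ) 1 1) * fE χ₁ χ₂ Complex.I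


section Helpers

/-- The period pair `(q z, 1)`. -/
noncomputable def Lz (q : ℕ) (hq : 1 < q) (z : ℂ) (hz : 0 < z.im) : PeriodPair where
  ω₁ := q * z
  ω₂ := 1
  indep := by
    rw [LinearIndependent.pair_iff]
    intro s t h
    have hq' : (q : ℝ) ≠ 0 := by positivity
    have h1 := congrArg Complex.im h
    have h2 := congrArg Complex.re h
    simp at h1 h2
    have hs : s = 0 := by
      rcases h1 with h1 | h1 | h1
      · exact h1
      · omega
      · exact absurd h1 hz.ne'
    subst hs
    simpa using h2

lemma mem_Lz {q : ℕ} {hq : 1 < q} {z : ℂ} {hz : 0 < z.im} {x : ℂ} :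
    x ∈ (Lz q hq z hz).lattice ↔ ∃ m n : ℤ, (m : ℂ) * (q * z) + n = x := by
  rw [PeriodPair.mem_lattice]
  simp [Lz]

lemma wp_scale (L L' : PeriodPair) (c : ℂ) (hc : c ≠ 0)
    (h : ∀ x, x ∈ L.lattice ↔ c * x ∈ L'.lattice) (u : ℂ) :
    L.weierstrassP u = c ^ 2 * L'.weierstrassP (c * u) := by
  let e : L.lattice ≃ L'.lattice :=
    { toFun := fun x => ⟨c * x.1, (h _).1 x.2⟩
      invFun := fun y => ⟨c⁻¹ * y.1, (h _).2 (by rw [mul_inv_cancel_left₀ hc]; exact y.2)⟩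
      left_inv := fun x => by ext; simp [hc]
      right_inv := fun x => by ext; simp [hc] }
  unfold PeriodPair.weierstrassP
  rw [← e.tsum_eq, ← tsum_mul_left]
  refine tsum_congr fun l => ?_
  simp only [e, Equiv.coe_fn_mk]
  rw [← mul_sub, mul_pow, mul_pow]
  have : c ^ 2 ≠ 0 := pow_ne_zero _ hc
  rw [one_div, one_div, one_div, one_div, mul_inv, mul_inv, ← mul_sub, mul_inv_cancel_left₀ this]

/-- The twisted sum of division values of `℘`. -/
noncomputable def Wsum {q₁ q₂ : ℕ} [NeZero q₁] [NeZero q₂] (h₁ : 1 < q₁)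
    (χ₁ : DirichletCharacter ℂ q₁) (χ₂ : DirichletCharacter ℂ q₂) (z : ℂ) (hz : 0 < z.im) : ℂ :=
  ∑ r : ZMod q₁, ∑ s : ZMod q₂, χ₁ r * χ₂ s *
    (Lz q₁ h₁ z hz).weierstrassP (r.val * z + s.val / q₂)

lemma wp_point {q₁ q₂ : ℕ} [NeZero q₁] [NeZero q₂] (h₁ : 1 < q₁) (z : ℂ) (hz : 0 < z.im)
    (x y : ℤ) : (Lz q₁ h₁ z hz).weierstrassP (x * z + y / q₂) =
    (Lz q₁ h₁ z hz).weierstrassP ((x : ZMod q₁).val * z + (y : ZMod q₂).val / q₂) := by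
  have hq2 : (q₂ : ℂ) ≠ 0 := NeZero.ne _
  have hx : (x : ℂ) = ((x : ZMod q₁).val : ℂ) + q₁ * ((x / q₁ : ℤ) : ℂ) := by
    have h := ZMod.val_intCast (n := q₁) x
    have h2 := Int.emod_add_mul_ediv x q₁
    rw [← h] at h2
    exact_mod_cast h2.symm
  have hy : (y : ℂ) = ((y : ZMod q₂).val : ℂ) + q₂ * ((y / q₂ : ℤ) : ℂ) := by
    have h := ZMod.val_intCast (n := q₂) y
    have h2 := Int.emod_add_mul_ediv y q₂
    rw [← h] at h2
    exact_mod_cast h2.symm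
  have hm : ((x / q₁ : ℤ) : ℂ) * (q₁ * z) + ((y / q₂ : ℤ) : ℂ) ∈ (Lz q₁ h₁ z hz).lattice :=
    mem_Lz.2 ⟨_, _, rfl⟩
  refine Eq.trans ?_ ((Lz q₁ h₁ z hz).weierstrassP_add_coe _ ⟨_, hm⟩)
  congr 1
  rw [hx, hy]
  simp only
  field_simp
  push_cast
  ring

lemma denom_ne (γ : Matrix.SpecialLinearGroup (Fin 2) ℤ) (z : ℂ) (hz : 0 < z.im) :
    ((γ.1 1 0 : ℤ) : ℂ) * z + ((γ.1 1 1 : ℤ) : ℂ) ≠ 0 := by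
  have hdet := γ.2
  rw [Matrix.det_fin_two] at hdet
  intro h
  have h1 := congrArg Complex.im h
  have h2 := congrArg Complex.re h
  simp at h1 h2
  rcases h1 with h1 | h1
  · rw [h1] at h2 hdet
    simp at h2
    rw [h2] at hdet
    simp at hdet
  · exact hz.ne' h1

lemma moebius_eq_smul (γ : Matrix.SpecialLinearGroup (Fin 2) ℤ) (z : UpperHalfPlane) :
    moebius γ z = ((γ • z : UpperHalfPlane) : ℂ) := by
  rw [UpperHalfPlane.specialLinearGroup_apply]
  simp [moebius]

lemma moebius_im (γ : Matrix.SpecialLinearGroup (Fin 2) ℤ) (z : ℂ) (hz : 0 < z.im) :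
    0 < (moebius γ z).im := by
  have := moebius_eq_smul γ ⟨z, hz⟩
  simp only at this
  rw [this]
  exact (γ • (⟨z, hz⟩ : UpperHalfPlane)).im_pos

lemma moebius_mul (γ₁ γ₂ : Matrix.SpecialLinearGroup (Fin 2) ℤ) (z : ℂ) (hz : 0 < z.im) :
    moebius (γ₁ * γ₂) z = moebius γ₁ (moebius γ₂ z) := by
  have := moebius_eq_smul (γ₁ * γ₂) ⟨z, hz⟩
  rw [mul_smul, ← moebius_eq_smul, ← moebius_eq_smul] at this
  exact this

lemma Wsum_moebius {q₁ q₂ : ℕ} [NeZero q₁] [NeZero q₂] (h₁ : 1 < q₁)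
    (χ₁ : DirichletCharacter ℂ q₁) (χ₂ : DirichletCharacter ℂ q₂)
    (γ : Matrix.SpecialLinearGroup (Fin 2) ℤ)
    (hγ : γ ∈ CongruenceSubgroup.Gamma0 (q₁ * q₂)) (z : ℂ) (hz : 0 < z.im) :
    Wsum h₁ χ₁ χ₂ (moebius γ z) (moebius_im γ z hz) =
      (((γ.1 1 0 : ℤ) : ℂ) * z + ((γ.1 1 1 : ℤ) : ℂ)) ^ 2 * psi χ₁ χ₂ (γ.1 1 1) *
        Wsum h₁ χ₁ χ₂ z hz := by
  have hdet := γ.2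
  rw [Matrix.det_fin_two] at hdet
  have hne := denom_ne γ z hz
  have hmob : moebius γ z = (((γ.1 0 0 : ℤ) : ℂ) * z + ((γ.1 0 1 : ℤ) : ℂ)) /
    (((γ.1 1 0 : ℤ) : ℂ) * z + ((γ.1 1 1 : ℤ) : ℂ)) := rfl
  rw [CongruenceSubgroup.Gamma0_mem, ZMod.intCast_zmod_eq_zero_iff_dvd] at hγ
  have him := moebius_im γ z hz
  change Wsum h₁ χ₁ χ₂ (moebius γ z) him = _
  generalize moebius γ z = w at *
  obtain ⟨c', hc'⟩ := hγ
  generalize γ.1 0 0 = a at *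
  generalize γ.1 0 1 = b at *
  generalize γ.1 1 0 = c at *
  generalize γ.1 1 1 = d at *
  push_cast at hc'
  have hq2 : (q₂ : ℂ) ≠ 0 := NeZero.ne _
  have hdetC : (a : ℂ) * d - b * c = 1 := by exact_mod_cast hdet
  have hcC : (c : ℂ) = q₁ * q₂ * c' := by rw [hc']; push_cast; ring
  have ha1 : (a : ZMod q₁) * d = 1 := by
    have := congrArg (Int.cast : ℤ → ZMod q₁) hdet
    rw [hc'] at this
    simpa using this
  have hd2 : (d : ZMod q₂) * a = 1 := by
    have := congrArg (Int.cast : ℤ → ZMod q₂) hdet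
    rw [hc'] at this
    simpa [mul_comm] using this
  have hlat : ∀ x, x ∈ (Lz q₁ h₁ w him).lattice ↔ (c * z + d) * x ∈ (Lz q₁ h₁ z hz).lattice := by
    intro x
    rw [mem_Lz, mem_Lz]
    have hw : (c * z + d) * w = a * z + b := by rw [hmob]; field_simp
    constructor
    · rintro ⟨m, n, rfl⟩
      refine ⟨m * a + n * q₂ * c', m * q₁ * b + n * d, ?_⟩
      push_cast
      linear_combination (-(m : ℂ) * q₁) * hw - n * z * hcC
    · rintro ⟨m, n, h⟩
      refine ⟨d * m - q₂ * c' * n, a * n - q₁ * b * m, ?_⟩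
      apply mul_left_cancel₀ hne
      rw [← h]
      push_cast
      linear_combination ((d * m - q₂ * c' * n) * q₁) * hw + (q₁ * m * z + n) * hdetC
        + (a * n * z + b * n) * hcC
  have key : ∀ r : ZMod q₁, ∀ s : ZMod q₂,
      (Lz q₁ h₁ w him).weierstrassP (r.val * w + s.val / q₂) =
      (c * z + d) ^ 2 * (Lz q₁ h₁ z hz).weierstrassP
        ((r * a : ZMod q₁).val * z + (s * d : ZMod q₂).val / q₂) := by
    intro r s
    rw [wp_scale _ _ _ hne hlat]
    congr 1
    have hp := wp_point (q₂ := q₂) h₁ z hz (r.val * a + s.val * q₁ * c') (s.val * d + q₂ * r.val * b)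
    have e1 : (((r.val * a + s.val * q₁ * c' : ℤ)) : ZMod q₁) = r * a := by simp
    have e2 : (((s.val * d + q₂ * r.val * b : ℤ)) : ZMod q₂) = s * d := by simp
    rw [e1, e2] at hp
    rw [← hp]
    congr 1
    rw [hmob]
    field_simp
    push_cast
    rw [hcC]
    ring
  unfold Wsum
  simp_rw [key]
  let ua : (ZMod q₁)ˣ := ⟨a, d, ha1, by rw [mul_comm]; exact ha1⟩
  let ud : (ZMod q₂)ˣ := ⟨d, a, hd2, by rw [mul_comm]; exact hd2⟩
  conv_rhs => rw [← Equiv.sum_comp (Units.mulRight ua), Finset.mul_sum]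
  refine Finset.sum_congr rfl fun r _ => ?_
  conv_rhs => rw [← Equiv.sum_comp (Units.mulRight ud), Finset.mul_sum]
  refine Finset.sum_congr rfl fun s _ => ?_
  simp only [Units.mulRight_apply, ua, ud, map_mul, psi]
  have k1 : χ₁ a * χ₁ d = 1 := by rw [← map_mul, ha1, map_one]
  have k2 : χ₂ d * (starRingEnd ℂ) (χ₂ d) = 1 := by
    rw [Complex.mul_conj, Complex.normSq_eq_norm_sq]
    have := DirichletCharacter.unit_norm_eq_one χ₂ ud
    simp only [ud] at this
    rw [this]; simp
  linear_combination (-(χ₁ r * χ₂ s * (c * z + d) ^ 2 * ((Lz q₁ h₁ z hz).weierstrassP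
        ((r * a : ZMod q₁).val * z + (s * d : ZMod q₂).val / q₂)))) * (k1 + k2 * (χ₁ a * χ₁ d))

end Helpers

section Deriv

lemma norm_eC_le (δ : ℝ) (l k : ℕ) (z : ℂ) (hz : δ ≤ z.im) :
    ‖eC ((k : ℂ) * (l : ℂ) * z)‖ ≤ Real.exp (-2 * Real.pi * δ) ^ (l * k) := by
  unfold eC
  rw [Complex.norm_exp, ← Real.exp_nat_mul]
  apply Real.exp_le_exp.2
  have : (2 * Real.pi * Complex.I * ((k : ℂ) * (l : ℂ) * z)).re = -(2 * Real.pi * (l * k) * z.im) := by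
    simp; ring
  rw [this]
  push_cast
  have h0 : 0 ≤ 2 * Real.pi * (l * k) := by positivity
  nlinarith [mul_le_mul_of_nonneg_left hz h0]

lemma rho_lt (δ : ℝ) (hδ : 0 < δ) : ‖Real.exp (-2 * Real.pi * δ)‖ < 1 := by
  rw [Real.norm_eq_abs, abs_of_pos (Real.exp_pos _), Real.exp_lt_one_iff]
  have := Real.pi_pos
  nlinarith [mul_pos this hδ]

variable {q₁ q₂ : ℕ} (χ₁ : DirichletCharacter ℂ q₁) (χ₂ : DirichletCharacter ℂ q₂)

/-- General term of `fE`. -/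
noncomputable def fterm (p : ℕ+ × ℕ+) (z : ℂ) : ℂ :=
  χ₁ ((p.1 : ℕ) : ZMod q₁) * (starRingEnd ℂ) (χ₂ ((p.2 : ℕ) : ZMod q₂)) / (p.1 : ℂ)
      * eC ((p.2 : ℂ) * (p.1 : ℂ) * z)

/-- General term of the derivative. -/
noncomputable def dterm (p : ℕ+ × ℕ+) (z : ℂ) : ℂ :=
  χ₁ ((p.1 : ℕ) : ZMod q₁) * (starRingEnd ℂ) (χ₂ ((p.2 : ℕ) : ZMod q₂)) * (p.2 : ℂ)
      * eC ((p.2 : ℂ) * (p.1 : ℂ) * z)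

lemma norm_chichi (a : ZMod q₁) (b : ZMod q₂) : ‖χ₁ a * (starRingEnd ℂ) (χ₂ b)‖ ≤ 1 := by
  rw [norm_mul, RCLike.norm_conj]
  exact mul_le_one₀ (χ₁.norm_le_one a) (norm_nonneg _) (χ₂.norm_le_one b)

lemma norm_dterm_le (δ : ℝ) (p : ℕ+ × ℕ+) (z : ℂ) (hz : δ ≤ z.im) :
    ‖dterm χ₁ χ₂ p z‖ ≤ (p.2 : ℝ) ^ 1 * Real.exp (-2 * Real.pi * δ) ^ ((p.1 : ℕ) * (p.2 : ℕ)) := by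
  unfold dterm
  rw [norm_mul, norm_mul, pow_one]
  have h1 := norm_chichi χ₁ χ₂ ((p.1 : ℕ) : ZMod q₁) ((p.2 : ℕ) : ZMod q₂)
  have h2 := norm_eC_le δ p.1 p.2 z hz
  have h3 : ‖((p.2 : ℕ) : ℂ)‖ = ((p.2 : ℕ) : ℝ) := by simp
  rw [h3]
  refine mul_le_mul ?_ h2 (norm_nonneg _) (by positivity)
  exact mul_le_of_le_one_left (by positivity) h1

lemma norm_fterm_le (p : ℕ+ × ℕ+) (z : ℂ) : ‖fterm χ₁ χ₂ p z‖ ≤ ‖eC ((p.2 : ℂ) * (p.1 : ℂ) * z)‖ := by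
  unfold fterm
  rw [norm_mul, norm_div]
  have h1 := norm_chichi χ₁ χ₂ ((p.1 : ℕ) : ZMod q₁) ((p.2 : ℕ) : ZMod q₂)
  have h3 : ‖((p.1 : ℕ) : ℂ)‖ = ((p.1 : ℕ) : ℝ) := by simp
  have h4 : (1 : ℝ) ≤ ((p.1 : ℕ) : ℝ) := by exact_mod_cast p.1.2
  rw [h3]
  refine mul_le_of_le_one_left (norm_nonneg _) ?_
  exact div_le_one_of_le₀ (h1.trans h4) (by positivity)

lemma summable_dterm (z : ℂ) (hz : 0 < z.im) : Summable (fun p => dterm χ₁ χ₂ p z) :=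
  Summable.of_norm_bounded (summable_prod_mul_pow 1 (rho_lt _ hz))
    (fun p => norm_dterm_le χ₁ χ₂ _ p z le_rfl)

lemma summable_fterm (z : ℂ) (hz : 0 < z.im) : Summable (fun p => fterm χ₁ χ₂ p z) :=
  Summable.of_norm_bounded (summable_prod_mul_pow 0 (rho_lt _ hz))
    (fun p => by
      rw [pow_zero, one_mul]
      exact (norm_fterm_le χ₁ χ₂ p z).trans (norm_eC_le _ _ _ _ le_rfl))

lemma hasDerivAt_fterm (p : ℕ+ × ℕ+) (z : ℂ) :
    HasDerivAt (fterm χ₁ χ₂ p) (2 * Real.pi * Complex.I * dterm χ₁ χ₂ p z) z := by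
  unfold fterm dterm eC
  have h : HasDerivAt (fun z : ℂ => 2 * Real.pi * Complex.I * ((p.2 : ℂ) * (p.1 : ℂ) * z))
      (2 * Real.pi * Complex.I * ((p.2 : ℂ) * (p.1 : ℂ))) z := by
    simpa using ((hasDerivAt_id z).const_mul ((p.2 : ℂ) * (p.1 : ℂ))).const_mul
      (2 * Real.pi * Complex.I)
  have h2 := h.cexp.const_mul
    (χ₁ ((p.1 : ℕ) : ZMod q₁) * (starRingEnd ℂ) (χ₂ ((p.2 : ℕ) : ZMod q₂)) / (p.1 : ℂ))
  refine h2.congr_deriv ?_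
  have : ((p.1 : ℕ) : ℂ) ≠ 0 := by simp
  field_simp

lemma hasDerivAt_fE (z : ℂ) (hz : 0 < z.im) :
    HasDerivAt (fE χ₁ χ₂) (2 * Real.pi * Complex.I * ∑' p, dterm χ₁ χ₂ p z) z := by
  have hU : IsOpen {w : ℂ | z.im / 2 < w.im} := isOpen_lt continuous_const Complex.continuous_im
  have hzU : z ∈ {w : ℂ | z.im / 2 < w.im} := by simp; linarith
  have key := hasDerivAt_tsum_of_isPreconnected (𝕜 := ℂ) (F := ℂ)
    (g := fun p w => fterm χ₁ χ₂ p w)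
    (g' := fun p w => 2 * Real.pi * Complex.I * dterm χ₁ χ₂ p w)
    ((summable_prod_mul_pow 1 (rho_lt (z.im / 2) (by linarith))).mul_left (‖2 * Real.pi * Complex.I‖))
    hU (convex_halfSpace_im_gt _).isPreconnected
    (fun p w _ => hasDerivAt_fterm χ₁ χ₂ p w)
    (fun p w hw => by
      rw [norm_mul]
      exact mul_le_mul_of_nonneg_left (norm_dterm_le χ₁ χ₂ _ p w (le_of_lt hw)) (norm_nonneg _))
    hzU (summable_fterm χ₁ χ₂ z hz) hzU
  rw [tsum_mul_left] at key
  refine key.congr_of_eventuallyEq ?_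
  filter_upwards [hU.mem_nhds hzU] with w hw
  have hw' : 0 < w.im := by
    have : z.im / 2 < w.im := hw
    linarith
  rw [(summable_fterm χ₁ χ₂ w hw').tsum_prod]
  rfl

end Deriv

section QExp

/-- `S(w) = ∑_n 1/(w+n)^2`. -/
noncomputable def Ssum (w : ℂ) : ℂ := ∑' n : ℤ, 1 / (w + n) ^ 2

lemma summable_S (w : ℂ) : Summable (fun n : ℤ => 1 / (w + n) ^ 2) := by
  have := EisensteinSeries.linear_right_summable w 1 (k := 2) le_rfl
  refine this.congr fun n => ?_
  rw [Int.cast_one, one_mul, one_div]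
  norm_cast

lemma Ssum_add_int (w : ℂ) (m : ℤ) : Ssum (w + m) = Ssum w := by
  unfold Ssum
  rw [← (Equiv.addLeft m).tsum_eq (fun n : ℤ => 1 / (w + n) ^ 2)]
  refine tsum_congr fun n => ?_
  simp [add_assoc]

lemma Ssum_neg (w : ℂ) : Ssum (-w) = Ssum w := by
  unfold Ssum
  rw [← (Equiv.neg ℤ).tsum_eq]
  refine tsum_congr fun n => ?_
  simp only [Equiv.neg_apply, Int.cast_neg]
  congr 1
  ring

variable {q₁ q₂ : ℕ} [NeZero q₁] [NeZero q₂]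
  (χ₁ : DirichletCharacter ℂ q₁) (χ₂ : DirichletCharacter ℂ q₂)

lemma Ssum_point (w : ℂ) (y : ℤ) :
    Ssum (w + y / q₂) = Ssum (w + (y : ZMod q₂).val / q₂) := by
  have hq2 : (q₂ : ℂ) ≠ 0 := NeZero.ne _
  have hy : (y : ℂ) = ((y : ZMod q₂).val : ℂ) + q₂ * ((y / q₂ : ℤ) : ℂ) := by
    have h := ZMod.val_intCast (n := q₂) y
    have h2 := Int.emod_add_mul_ediv y q₂
    rw [← h] at h2
    exact_mod_cast h2.symm
  rw [← Ssum_add_int (w + (y : ZMod q₂).val / q₂) (y / q₂)]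
  congr 1
  rw [hy]
  field_simp
  ring

/-- Row sums. -/
noncomputable def Rrow (z : ℂ) (l : ℤ) : ℂ :=
  ∑ s : ZMod q₂, χ₂ s * Ssum (l * z + s.val / q₂)

lemma Rrow_neg (z : ℂ) (l : ℤ) : Rrow χ₂ z (-l) = χ₂ (-1) * Rrow χ₂ z l := by
  unfold Rrow
  rw [← Equiv.sum_comp (Equiv.neg (ZMod q₂)), Finset.mul_sum]
  refine Finset.sum_congr rfl fun s _ => ?_
  simp only [Equiv.neg_apply]
  have h1 : χ₂ (-s) = χ₂ (-1) * χ₂ s := by rw [← map_mul, neg_one_mul]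
  have h2 := Ssum_point (q₂ := q₂) ((-l : ℤ) * z) (-(s.val : ℤ))
  have h3 : ((-(s.val : ℤ) : ℤ) : ZMod q₂) = -s := by simp
  rw [h3] at h2
  rw [← h2, h1, mul_assoc, ← Ssum_neg (l * z + s.val / q₂)]
  congr 3
  push_cast
  ring

lemma gauss_ne (h₂ : χ₂.IsPrimitive) : gaussSum χ₂ ZMod.stdAddChar ≠ 0 := by
  intro h
  have h0 : ZMod.dft (χ₂ : ZMod q₂ → ℂ) = 0 := by
    funext k
    rw [h₂.fourierTransform_eq_inv_mul_gaussSum, h, mul_zero]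
    rfl
  have h1 := (LinearEquiv.map_eq_zero_iff _).1 h0
  have := congrFun h1 1
  simp at this

lemma gauss_twist (h₂ : χ₂.IsPrimitive) (k : ℕ) :
    ∑ s : ZMod q₂, χ₂ s * Complex.exp (2 * Real.pi * Complex.I * (s.val / q₂)) ^ k =
      (starRingEnd ℂ) (χ₂ (k : ZMod q₂)) * gaussSum χ₂ ZMod.stdAddChar := by
  have h := gaussSum_mulShift_of_isPrimitive (ZMod.stdAddChar (N := q₂)) h₂ (k : ZMod q₂)
  have hs : (starRingEnd ℂ) (χ₂ (k : ZMod q₂)) = χ₂⁻¹ (k : ZMod q₂) := MulChar.star_apply' χ₂ _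
  rw [hs, ← h, gaussSum]
  refine Finset.sum_congr rfl fun s _ => ?_
  rw [AddChar.mulShift_apply]
  have : (k : ZMod q₂) * s = ((k * s.val : ℤ) : ZMod q₂) := by simp
  rw [this, ZMod.stdAddChar_coe, ← Complex.exp_nat_mul]
  congr 2
  push_cast
  ring

lemma Rrow_pos (h₂ : χ₂.IsPrimitive) (z : ℂ) (hz : 0 < z.im) (l : ℕ+) :
    χ₁ ((l : ℕ) : ZMod q₁) * Rrow χ₂ z ((l : ℕ) : ℤ) =
      (2 * Real.pi * Complex.I) ^ 2 * gaussSum χ₂ ZMod.stdAddChar *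
        ∑' k : ℕ+, dterm χ₁ χ₂ (l, k) z := by
  have him : ∀ s : ZMod q₂, 0 < ((((l : ℕ) : ℤ) : ℂ) * z + s.val / q₂).im := by
    intro s
    have h1 : ((s.val : ℂ) / (q₂ : ℂ)).im = 0 := by
      have : ((s.val : ℂ) / (q₂ : ℂ)) = ((s.val / q₂ : ℝ) : ℂ) := by push_cast; rfl
      rw [this, Complex.ofReal_im]
    rw [Complex.add_im, h1]
    simp
    exact hz
  have hS : ∀ s : ZMod q₂, Ssum ((((l : ℕ) : ℤ) : ℂ) * z + s.val / q₂) =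
      (2 * Real.pi * Complex.I) ^ 2 * ∑' k : ℕ+, ((k : ℕ) : ℂ) *
        (eC ((k : ℂ) * (l : ℂ) * z) * Complex.exp (2 * Real.pi * Complex.I * (s.val / q₂)) ^ (k : ℕ)) := by
    intro s
    have := EisensteinSeries.qExpansion_identity_pnat (k := 1) le_rfl ⟨_, him s⟩
    simp only [Nat.reduceAdd, Nat.factorial_one, Nat.cast_one, div_one, pow_one] at this
    unfold Ssum
    rw [this]
    congr 1
    · ring
    · refine tsum_congr fun k => ?_
      congr 1
      rw [eC, ← Complex.exp_nat_mul, ← Complex.exp_nat_mul, ← Complex.exp_add]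
      congr 1
      push_cast
      ring
  have hsum : ∀ s : ZMod q₂, Summable (fun k : ℕ+ => ((k : ℕ) : ℂ) *
        (eC ((k : ℂ) * (l : ℂ) * z) *
          Complex.exp (2 * Real.pi * Complex.I * (s.val / q₂)) ^ (k : ℕ))) := by
    intro s
    have h1 := (summable_prod_mul_pow 1 (rho_lt _ hz)).prod_factor l
    refine Summable.of_norm_bounded h1 fun k => ?_
    have hn : ‖Complex.exp (2 * Real.pi * Complex.I * (s.val / q₂))‖ = 1 := by
      have : (2 * Real.pi * Complex.I * ((s.val : ℂ) / q₂)) =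
        ((2 * Real.pi * (s.val / q₂) : ℝ) : ℂ) * Complex.I := by push_cast; ring
      rw [this, Complex.norm_exp_ofReal_mul_I]
    rw [norm_mul, norm_mul, norm_pow, hn, one_pow, mul_one, pow_one]
    refine mul_le_mul (by simp) (norm_eC_le _ _ _ _ le_rfl) (norm_nonneg _) (by positivity)
  unfold Rrow
  simp_rw [hS, ← tsum_mul_left]
  rw [← Summable.tsum_finsetSum (fun s _ => (((hsum s).mul_left _).mul_left _)), ← tsum_mul_left]
  refine tsum_congr fun k => ?_
  have hg := gauss_twist χ₂ h₂ k
  calc _ = χ₁ ((l : ℕ) : ZMod q₁) * ((2 * Real.pi * Complex.I) ^ 2 * ((k : ℕ) : ℂ) *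
        eC ((k : ℂ) * (l : ℂ) * z)) * ∑ s : ZMod q₂, χ₂ s * Complex.exp (2 * Real.pi * Complex.I * (s.val / q₂)) ^ (k : ℕ) := by
        rw [Finset.mul_sum, Finset.mul_sum]
        refine Finset.sum_congr rfl fun s _ => ?_
        ring
    _ = _ := by
        rw [hg, dterm]
        ring

/-- Division with remainder. -/
noncomputable def divEquiv (q : ℕ) [NeZero q] : ℤ × ZMod q ≃ ℤ where
  toFun p := p.2.val + q * p.1
  invFun l := (l / q, (l : ZMod q))
  left_inv p := by
    have hq : (0 : ℤ) < q := by exact_mod_cast Nat.pos_of_ne_zero (NeZero.ne q)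
    have h1 : (p.2.val : ℤ) < q := by exact_mod_cast ZMod.val_lt p.2
    ext
    · simp only
      rw [Int.add_mul_ediv_left _ _ hq.ne', Int.ediv_eq_zero_of_lt (by positivity) h1, zero_add]
    · simp
  right_inv l := by
    simp only
    rw [ZMod.val_intCast]
    exact Int.emod_add_mul_ediv l q

lemma Hrow_even (hpar : χ₁ (-1) * χ₂ (-1) = 1) (z : ℂ) :
    Function.Even (fun l : ℤ => χ₁ (l : ZMod q₁) * Rrow χ₂ z l) := by
  intro l
  simp only
  rw [Rrow_neg, Int.cast_neg, ← neg_one_mul (l : ZMod q₁), map_mul]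
  linear_combination (χ₁ (l : ZMod q₁) * Rrow χ₂ z l) * hpar

lemma Hrow_summable (h₂ : χ₂.IsPrimitive) (hpar : χ₁ (-1) * χ₂ (-1) = 1) (z : ℂ) (hz : 0 < z.im) :
    Summable (fun l : ℤ => χ₁ (l : ZMod q₁) * Rrow χ₂ z l) := by
  have h1 : Summable (fun l : ℕ+ => χ₁ (((l : ℕ) : ℤ) : ZMod q₁) * Rrow χ₂ z ((l : ℕ) : ℤ)) := by
    have := ((summable_dterm χ₁ χ₂ z hz).prod).mul_left
      ((2 * Real.pi * Complex.I) ^ 2 * gaussSum χ₂ ZMod.stdAddChar)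
    refine this.congr fun l => ?_
    rw [← Rrow_pos χ₁ χ₂ h₂ z hz l, Int.cast_natCast]
  have h2 : Summable (fun l : ℕ => χ₁ ((l : ℤ) : ZMod q₁) * Rrow χ₂ z (l : ℤ)) :=
    (summable_pnat_iff_summable_nat
      (f := fun l : ℕ => χ₁ ((l : ℤ) : ZMod q₁) * Rrow χ₂ z (l : ℤ))).1 h1
  refine Summable.of_nat_of_neg h2 ?_
  refine h2.congr fun l => ?_
  exact (Hrow_even χ₁ χ₂ hpar z l).symm

lemma Wsum_eq (h₁ : 1 < q₁) (hq₂ : 1 < q₂) (h₂ : χ₂.IsPrimitive)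
    (hpar : χ₁ (-1) * χ₂ (-1) = 1) (z : ℂ) (hz : 0 < z.im) :
    Wsum h₁ χ₁ χ₂ z hz = 2 * ((2 * Real.pi * Complex.I) ^ 2 * gaussSum χ₂ ZMod.stdAddChar) *
      ∑' p, dterm χ₁ χ₂ p z := by
  have hχ : χ₂ ≠ 1 := by
    rintro rfl
    rw [DirichletCharacter.isPrimitive_def, DirichletCharacter.conductor_one] at h₂
    omega
  have hsum0 : ∑ s : ZMod q₂, χ₂ s = 0 := MulChar.sum_eq_zero_of_ne_one hχ
  set L := Lz q₁ h₁ z hz with hL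
  have hW : HasSum (fun ω : L.lattice => ∑ r : ZMod q₁, ∑ s : ZMod q₂, χ₁ r * χ₂ s *
      (1 / (r.val * z + s.val / q₂ - ω) ^ 2)) (Wsum h₁ χ₁ χ₂ z hz) := by
    have h : HasSum (fun ω : L.lattice => ∑ r : ZMod q₁, ∑ s : ZMod q₂, χ₁ r * χ₂ s *
      (1 / (r.val * z + s.val / q₂ - ω) ^ 2 - 1 / (ω : ℂ) ^ 2)) (Wsum h₁ χ₁ χ₂ z hz) :=
      hasSum_sum fun r _ => hasSum_sum fun s _ => (L.hasSum_weierstrassP _).mul_left _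
    convert! h using 2 with ω
    refine Finset.sum_congr rfl fun r _ => ?_
    simp_rw [mul_sub, Finset.sum_sub_distrib]
    rw [← Finset.sum_mul, ← Finset.mul_sum, hsum0]
    simp
  have hW2 : HasSum (fun p : ℤ × ℤ => ∑ r : ZMod q₁, ∑ s : ZMod q₂, χ₁ r * χ₂ s *
      (1 / (((r.val + q₁ * p.1 : ℤ) : ℂ) * z + s.val / q₂ + p.2) ^ 2)) (Wsum h₁ χ₁ χ₂ z hz) := by
    let e : ℤ × ℤ ≃ L.lattice := (Equiv.neg (ℤ × ℤ)).trans L.latticeEquivProd.symm.toEquiv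
    refine ((e.hasSum_iff).2 hW).congr_fun ?_
    intro p
    have he : ((e p : L.lattice) : ℂ) = -(p.1 * (q₁ * z) + p.2) := by
      have := L.latticeEquiv_symm_apply (-p)
      change ((L.latticeEquivProd.symm (-p)).1 : ℂ) = _
      rw [this]
      simp [hL, Lz]
      ring
    simp only [Function.comp, he]
    refine Finset.sum_congr rfl fun r _ => Finset.sum_congr rfl fun s _ => ?_
    congr 3
    push_cast
    ring
  rw [← hW2.tsum_eq, hW2.summable.tsum_prod]
  have hrow : ∀ m : ℤ, ∑' n : ℤ, ∑ r : ZMod q₁, ∑ s : ZMod q₂, χ₁ r * χ₂ s *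
      (1 / (((r.val + q₁ * m : ℤ) : ℂ) * z + s.val / q₂ + n) ^ 2) =
      ∑' r : ZMod q₁, χ₁ ((divEquiv q₁ (m, r) : ℤ) : ZMod q₁) * Rrow χ₂ z (divEquiv q₁ (m, r)) := by
    intro m
    rw [tsum_fintype (β := ZMod q₁), Summable.tsum_finsetSum
      (fun r _ => summable_sum fun s _ => (summable_S _).mul_left _)]
    refine Finset.sum_congr rfl fun r _ => ?_
    rw [Summable.tsum_finsetSum (fun s _ => (summable_S _).mul_left _), Rrow, Finset.mul_sum]
    refine Finset.sum_congr rfl fun s _ => ?_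
    rw [tsum_mul_left]
    have : ((divEquiv q₁ (m, r) : ℤ) : ZMod q₁) = r := by simp [divEquiv]
    rw [this, mul_assoc]
    rfl
  simp_rw [hrow]
  have hs := Hrow_summable χ₁ χ₂ h₂ hpar z hz
  have hp := ((divEquiv q₁).summable_iff.2 hs).tsum_prod
  simp only [Function.comp] at hp
  rw [← hp, (divEquiv q₁).tsum_eq (fun l : ℤ => χ₁ (l : ZMod q₁) * Rrow χ₂ z l),
    tsum_int_eq_zero_add_two_mul_tsum_pnat (Hrow_even χ₁ χ₂ hpar z) hs,
    (summable_dterm χ₁ χ₂ z hz).tsum_prod]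
  have h0 : χ₁ ((0 : ℤ) : ZMod q₁) = 0 := by
    have : Fact (1 < q₁) := ⟨h₁⟩
    rw [Int.cast_zero]
    exact MulChar.map_zero _
  rw [h0, zero_mul, zero_add, two_smul, ← two_mul, mul_assoc, ← tsum_mul_left (a := (_ * _ : ℂ))]
  congr 1
  refine tsum_congr fun l => ?_
  rw [← Rrow_pos χ₁ χ₂ h₂ z hz l, Int.cast_natCast]

end QExp

lemma hasDerivAt_moebius (γ : Matrix.SpecialLinearGroup (Fin 2) ℤ) (z : ℂ) (hz : 0 < z.im) :
    HasDerivAt (moebius γ) (1 / (((γ.1 1 0 : ℤ) : ℂ) * z + ((γ.1 1 1 : ℤ) : ℂ)) ^ 2) z := by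
  have hdet := γ.2
  rw [Matrix.det_fin_two] at hdet
  have hdetC : ((γ.1 0 0 : ℤ) : ℂ) * (γ.1 1 1 : ℤ) - (γ.1 0 1 : ℤ) * (γ.1 1 0 : ℤ) = 1 := by
    exact_mod_cast hdet
  have hne := denom_ne γ z hz
  have h1 : HasDerivAt (fun z : ℂ => ((γ.1 0 0 : ℤ) : ℂ) * z + ((γ.1 0 1 : ℤ) : ℂ))
      ((γ.1 0 0 : ℤ) : ℂ) z := by
    simpa using ((hasDerivAt_id z).const_mul ((γ.1 0 0 : ℤ) : ℂ)).add_const ((γ.1 0 1 : ℤ) : ℂ)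
  have h2 : HasDerivAt (fun z : ℂ => ((γ.1 1 0 : ℤ) : ℂ) * z + ((γ.1 1 1 : ℤ) : ℂ))
      ((γ.1 1 0 : ℤ) : ℂ) z := by
    simpa using ((hasDerivAt_id z).const_mul ((γ.1 1 0 : ℤ) : ℂ)).add_const ((γ.1 1 1 : ℤ) : ℂ)
  refine (h1.div h2 hne).congr_deriv ?_
  congr 1
  linear_combination hdetC

lemma fE_const {q₁ q₂ : ℕ} (hq₁ : 1 < q₁) (hq₂ : 1 < q₂)
    (χ₁ : DirichletCharacter ℂ q₁) (χ₂ : DirichletCharacter ℂ q₂)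
    (hχ₂ : χ₂.IsPrimitive) (hpar : χ₁ (-1) * χ₂ (-1) = 1)
    (γ : Matrix.SpecialLinearGroup (Fin 2) ℤ)
    (hγ : γ ∈ CongruenceSubgroup.Gamma0 (q₁ * q₂)) (z w : ℂ) (hz : 0 < z.im) (hw : 0 < w.im) :
    fE χ₁ χ₂ (moebius γ z) - psi χ₁ χ₂ (γ.1 1 1) * fE χ₁ χ₂ z =
    fE χ₁ χ₂ (moebius γ w) - psi χ₁ χ₂ (γ.1 1 1) * fE χ₁ χ₂ w := by
  have : NeZero q₁ := ⟨by omega⟩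
  have : NeZero q₂ := ⟨by omega⟩
  have hd : ∀ u : ℂ, 0 < u.im → HasDerivAt
      (fun z => fE χ₁ χ₂ (moebius γ z) - psi χ₁ χ₂ (γ.1 1 1) * fE χ₁ χ₂ z) 0 u := by
    intro u hu
    have hmu := moebius_im γ u hu
    have h1 := (hasDerivAt_fE χ₁ χ₂ _ hmu).comp u (hasDerivAt_moebius γ u hu)
    have h2 := (hasDerivAt_fE χ₁ χ₂ u hu).const_mul (psi χ₁ χ₂ (γ.1 1 1))
    refine (h1.sub h2).congr_deriv ?_
    have hne := denom_ne γ u hu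
    have e := Wsum_moebius hq₁ χ₁ χ₂ γ hγ u hu
    rw [Wsum_eq χ₁ χ₂ hq₁ hq₂ hχ₂ hpar, Wsum_eq χ₁ χ₂ hq₁ hq₂ hχ₂ hpar] at e
    have hK : 2 * ((2 * Real.pi * Complex.I) ^ 2 * gaussSum χ₂ ZMod.stdAddChar) ≠ 0 :=
      mul_ne_zero two_ne_zero (mul_ne_zero (pow_ne_zero _ Complex.two_pi_I_ne_zero)
        (gauss_ne χ₂ hχ₂))
    have e' : ∑' p, dterm χ₁ χ₂ p (moebius γ u) =
        (((γ.1 1 0 : ℤ) : ℂ) * u + ((γ.1 1 1 : ℤ) : ℂ)) ^ 2 * psi χ₁ χ₂ (γ.1 1 1) *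
          ∑' p, dterm χ₁ χ₂ p u := by
      apply mul_left_cancel₀ hK
      rw [e]
      ring
    rw [e']
    field_simp
    ring
  exact (isOpen_lt continuous_const Complex.continuous_im).is_const_of_deriv_eq_zero
    (s := {u : ℂ | 0 < u.im}) (convex_halfSpace_im_gt 0).isPreconnected
    (fun u hu => (hd u hu).differentiableAt.differentiableWithinAt)
    (fun u hu => (hd u hu).deriv) hz hw

lemma psi_mul {q₁ q₂ : ℕ} (χ₁ : DirichletCharacter ℂ q₁) (χ₂ : DirichletCharacter ℂ q₂)
    (γ₁ γ₂ : Matrix.SpecialLinearGroup (Fin 2) ℤ)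
    (hγ₁ : γ₁ ∈ CongruenceSubgroup.Gamma0 (q₁ * q₂)) :
    psi χ₁ χ₂ ((γ₁ * γ₂).1 1 1) = psi χ₁ χ₂ (γ₁.1 1 1) * psi χ₁ χ₂ (γ₂.1 1 1) := by
  rw [CongruenceSubgroup.Gamma0_mem, ZMod.intCast_zmod_eq_zero_iff_dvd] at hγ₁
  obtain ⟨c, hc⟩ := hγ₁
  have h : (γ₁ * γ₂).1 1 1 = γ₁.1 1 0 * γ₂.1 0 1 + γ₁.1 1 1 * γ₂.1 1 1 := by
    simp [Matrix.mul_apply, Fin.sum_univ_two]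
  rw [h, hc]
  simp only [psi]
  push_cast
  simp only [CharP.cast_eq_zero, zero_mul, mul_zero, zero_add, map_mul]
  ring

theorem phi_crossed_homomorphism
    {q₁ q₂ : ℕ} (hq₁ : 1 < q₁) (hq₂ : 1 < q₂)
    (χ₁ : DirichletCharacter ℂ q₁) (χ₂ : DirichletCharacter ℂ q₂)
    (hχ₁ : χ₁.IsPrimitive) (hχ₂ : χ₂.IsPrimitive)
    (hpar : χ₁ (-1) * χ₂ (-1) = 1)
    (γ₁ γ₂ : Matrix.SpecialLinearGroup (Fin 2) ℤ)
    (hγ₁ : γ₁ ∈ CongruenceSubgroup.Gamma0 (q₁ * q₂))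
    (hγ₂ : γ₂ ∈ CongruenceSubgroup.Gamma0 (q₁ * q₂)) :
    phi χ₁ χ₂ (γ₁ * γ₂) =
      phi χ₁ χ₂ γ₁ +
        psi χ₁ χ₂ ((γ₁ : Matrix (Fin 2) (Fin 2) ℤ) 1 1) * phi χ₁ χ₂ γ₂ := by
  have hI : 0 < Complex.I.im := by simp
  have h := fE_const hq₁ hq₂ χ₁ χ₂ hχ₂ hpar γ₁ hγ₁ (moebius γ₂ Complex.I) Complex.I
    (moebius_im γ₂ _ hI) hI
  have hm := psi_mul χ₁ χ₂ γ₁ γ₂ hγ₁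
  unfold phi
  rw [hm, moebius_mul γ₁ γ₂ _ hI]
  linear_combination h
end

section
/- Let χ₁, χ₂ be primitive Dirichlet characters of conductors q₁, q₂ respectively, with q₁, q₂ > 1 and χ₁(−1)χ₂(−1) = 1. Then as u → 0 from the right, f_{χ₁,χ₂}(iu) tends to −L(1,χ₁) · ∑_{n=1}^{q₂−1} conj(χ₂)(n) · B₁(n/q₂). -/
open Complex

open Filter Topology Finset in
theorem aux_toeplitz {ι : Type*} {F : Filter ι} (a : ℕ → ℂ) (A c : ℂ) (w : ι → ℕ → ℂ) (V : ℝ)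
    (hA : Tendsto (fun N => ∑ i ∈ range N, a i) atTop (𝓝 A))
    (hV : ∀ᶠ t in F, ∀ N, ∑ i ∈ range N, ‖w t i - w t (i+1)‖ ≤ V)
    (hc : ∀ i, Tendsto (fun t => w t i) F (𝓝 c))
    (hs : ∀ᶠ t in F, Summable (fun i => a i * w t i))
    (hw : ∀ᶠ t in F, Tendsto (w t) atTop (𝓝 0)) :
    Tendsto (fun t => ∑' i, a i * w t i) F (𝓝 (A * c)) := by
  set T : ℕ → ℂ := fun N => ∑ i ∈ range N, a i - A with hT
  have hT0 : Tendsto T atTop (𝓝 0) := by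
    have := hA.sub_const A
    simpa [hT] using this
  have hid : ∀ t N, ∑ i ∈ range N, a i * w t i
      = T N * w t N + A * w t 0 + ∑ i ∈ range N, T (i+1) * (w t i - w t (i+1)) := by
    intro t N
    induction N with
    | zero => simp [hT]
    | succ N ih =>
      rw [sum_range_succ, ih, sum_range_succ]
      have : T (N+1) = T N + a N := by simp only [hT, sum_range_succ]; ring
      rw [this]; ring
  have hVp : ∀ᶠ t in F, 0 ≤ V := by
    filter_upwards [hV] with t ht
    simpa using ht 0
  have key : Tendsto (fun t => ∑' i, a i * w t i - A * w t 0) F (𝓝 0) := by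
    rw [Metric.tendsto_nhds]
    intro ε hε
    by_cases hVn : V < 0
    · filter_upwards [hVp] with t ht
      linarith
    push Not at hVn
    set δ := ε / (2 * (V + 1)) with hδ
    have hδp : 0 < δ := by positivity
    obtain ⟨M, hM⟩ := (Metric.tendsto_atTop.1 hT0) δ hδp
    have hfin : Tendsto (fun t => ∑ i ∈ range M, ‖T (i+1)‖ * ‖w t i - w t (i+1)‖) F (𝓝 0) := by
      have : Tendsto (fun t => ∑ i ∈ range M, ‖T (i+1)‖ * ‖w t i - w t (i+1)‖) F
          (𝓝 (∑ i ∈ range M, ‖T (i+1)‖ * ‖c - c‖)) :=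
        tendsto_finsetSum _ fun i _ => (((hc i).sub (hc (i+1))).norm).const_mul _
      simpa using this
    have hfin' := hfin.eventually (gt_mem_nhds (half_pos (half_pos hε)))
    filter_upwards [hfin', hV, hs, hw] with t h1 h2 h3 h4
    have hb : ∀ N, ‖∑ i ∈ range N, T (i+1) * (w t i - w t (i+1))‖ ≤ ε/2/2 + δ * V := by
      intro N
      calc _ ≤ ∑ i ∈ range N, ‖T (i+1)‖ * ‖w t i - w t (i+1)‖ := by
            refine (norm_sum_le _ _).trans (le_of_eq ?_)
            simp
        _ ≤ ∑ i ∈ range N, ((if i < M then ‖T (i+1)‖ * ‖w t i - w t (i+1)‖ else 0)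
              + δ * ‖w t i - w t (i+1)‖) := by
            refine sum_le_sum fun i _ => ?_
            split_ifs with h
            · have := mul_nonneg hδp.le (norm_nonneg (w t i - w t (i+1)))
              linarith
            · have := hM (i+1) (by omega)
              rw [dist_zero_right] at this
              rw [zero_add]
              gcongr
        _ = ∑ i ∈ range N with i < M, ‖T (i+1)‖ * ‖w t i - w t (i+1)‖
              + δ * ∑ i ∈ range N, ‖w t i - w t (i+1)‖ := by
            rw [sum_add_distrib, ← sum_filter, mul_sum]
        _ ≤ ∑ i ∈ range M, ‖T (i+1)‖ * ‖w t i - w t (i+1)‖ + δ * V := by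
            refine add_le_add ?_ (mul_le_mul_of_nonneg_left (h2 N) hδp.le)
            refine sum_le_sum_of_subset_of_nonneg ?_ fun i _ _ => by positivity
            intro i hi
            simp at hi ⊢
            exact hi.2
        _ ≤ _ := by linarith
    have hl : Tendsto (fun N => ∑ i ∈ range N, a i * w t i - T N * w t N - A * w t 0) atTop
        (𝓝 (∑' i, a i * w t i - 0 * 0 - A * w t 0)) :=
      (h3.hasSum.tendsto_sum_nat.sub (hT0.mul h4)).sub_const _
    have hle := le_of_tendsto' hl.norm (b := ε/2/2 + δ * V) fun N => by
      rw [hid]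
      refine le_trans (le_of_eq (congrArg norm ?_)) (hb N)
      ring
    rw [dist_zero_right]
    have : δ * V ≤ ε / 2 := by
      rw [hδ, div_mul_eq_mul_div, div_le_div_iff₀ (by positivity) (by positivity)]
      nlinarith
    simp only [mul_zero, sub_zero] at hle
    linarith
  have := key.add ((hc 0).const_mul A)
  simpa using this

open Finset in
theorem aux_sum_range {q : ℕ} [NeZero q] (g : ZMod q → ℂ) :
    ∑ n ∈ range q, g (n : ZMod q) = ∑ x, g x := by
  refine sum_bij' (fun n _ => (n : ZMod q)) (fun x _ => x.val) ?_ ?_ ?_ ?_ ?_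
  · simp
  · intro x _; simpa using ZMod.val_lt x
  · intro n hn; exact ZMod.val_cast_of_lt (by simpa using hn)
  · simp
  · simp

open Finset in
theorem aux_bdd {q : ℕ} [NeZero q] (g : ZMod q → ℂ) (h : ∑ x, g x = 0) :
    ∃ b : ℝ, ∀ N, ‖∑ n ∈ range N, g (n : ZMod q)‖ ≤ b := by
  have hp : Function.Periodic (fun N => ∑ n ∈ range N, g (n : ZMod q)) q := by
    intro N
    simp only
    rw [add_comm, sum_range_add, aux_sum_range, h, zero_add]
    simp
  refine ⟨∑ N ∈ range q, ‖∑ n ∈ range N, g (n : ZMod q)‖, fun N => ?_⟩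
  have := hp.map_mod_nat N
  rw [← this]
  exact single_le_sum (f := fun N => ‖∑ n ∈ range N, g (n : ZMod q)‖) (fun _ _ => norm_nonneg _)
    (mem_range.2 (Nat.mod_lt _ (Nat.pos_of_ne_zero (NeZero.ne q))))

open Filter Topology Finset in
theorem aux_antitone_var (y : ℕ → ℝ) (hy : Antitone y) (h0 : y 0 ≤ 1) (hn : ∀ i, 0 ≤ y i) (N : ℕ) :
    ∑ i ∈ range N, |y i - y (i+1)| ≤ 1 := by
  have : ∑ i ∈ range N, |y i - y (i+1)| = ∑ i ∈ range N, (y i - y (i+1)) :=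
    sum_congr rfl fun i _ => abs_of_nonneg (by linarith [hy (Nat.le_succ i)])
  rw [this, sum_range_sub']
  linarith [hn N]

open Filter Topology Finset in
theorem aux_L {q : ℕ} [NeZero q] (χ : DirichletCharacter ℂ q) (hχ : χ ≠ 1) :
    Tendsto (fun N => ∑ i ∈ range N, χ ((i+1 : ℕ) : ZMod q) / ((i+1 : ℕ) : ℂ)) atTop
      (𝓝 (χ.LFunction 1)) := by
  have hsum : ∑ x, χ x = 0 := MulChar.sum_eq_zero_of_ne_one hχ
  obtain ⟨b, hb⟩ := aux_bdd (fun x => χ (x + 1))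
    (by rw [← hsum]; exact Fintype.sum_equiv (Equiv.addRight 1) _ _ (fun x => rfl))
  have hcs := Antitone.cauchySeq_series_mul_of_tendsto_zero_of_bounded (E := ℂ) (b := b)
    (f := fun i : ℕ => 1 / ((i : ℝ) + 1)) (z := fun i : ℕ => χ ((i+1 : ℕ) : ZMod q))
    (fun i j hij => by
      apply one_div_le_one_div_of_le (by positivity)
      have : (i : ℝ) ≤ j := by exact_mod_cast hij
      linarith) tendsto_one_div_add_atTop_nhds_zero_nat
    (fun N => by simpa using hb N)
  obtain ⟨A, hA⟩ := cauchySeq_tendsto_of_complete hcs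
  have hA' : Tendsto (fun N => ∑ i ∈ range N, χ ((i+1 : ℕ) : ZMod q) / ((i+1 : ℕ) : ℂ)) atTop
      (𝓝 A) := by
    refine hA.congr fun N => sum_congr rfl fun i _ => ?_
    rw [Complex.real_smul]
    push_cast
    ring
  have hterm : ∀ s : ℝ, 0 < s → ∀ i : ℕ, χ ((i+1 : ℕ) : ZMod q) / ((i+1 : ℕ) : ℂ)
      * ((((i : ℝ) + 1) ^ (-s) : ℝ) : ℂ) = LSeries.term (fun n => χ (n : ZMod q)) (1 + s : ℂ) (i+1) := by
    intro s hs i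
    rw [LSeries.term_of_ne_zero (by omega), div_mul_eq_mul_div, mul_div_assoc]
    have hne : ((i : ℂ) + 1) ≠ 0 := by exact_mod_cast Nat.succ_ne_zero i
    have : ((((i : ℝ) + 1) ^ (-s) : ℝ) : ℂ) = ((i : ℂ) + 1) ^ (-s : ℂ) := by
      rw [Complex.ofReal_cpow (by positivity)]; push_cast; rfl
    rw [this]
    push_cast
    rw [Complex.cpow_add _ _ hne, Complex.cpow_neg, Complex.cpow_one]
    field_simp
  have hre : ∀ s : ℝ, 0 < s → 1 < (1 + s : ℂ).re := by intro s hs; simpa using hs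
  have hT := aux_toeplitz (F := 𝓝[>] (0:ℝ)) _ A 1
    (fun s i => ((((i : ℝ) + 1) ^ (-s) : ℝ) : ℂ)) 1 hA' ?_ ?_ ?_ ?_
  · have h2 : Tendsto (fun s : ℝ => χ.LFunction (1 + s)) (𝓝[>] 0) (𝓝 (χ.LFunction 1)) := by
      have : Continuous (fun s : ℝ => χ.LFunction (1 + s)) :=
        (DirichletCharacter.differentiable_LFunction hχ).continuous.comp (by fun_prop)
      have := (this.tendsto 0).mono_left (nhdsWithin_le_nhds (s := Set.Ioi 0))
      simpa using this
    have h3 : A = χ.LFunction 1 := by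
      rw [mul_one] at hT
      refine tendsto_nhds_unique (hT.congr' ?_) h2
      filter_upwards [self_mem_nhdsWithin] with s hs
      rw [DirichletCharacter.LFunction_eq_LSeries χ (hre s hs), LSeries,
        (DirichletCharacter.LSeriesSummable_of_one_lt_re χ (hre s hs)).tsum_eq_zero_add,
        LSeries.term_zero, zero_add]
      exact tsum_congr (hterm s hs)
    rwa [← h3]
  · filter_upwards [self_mem_nhdsWithin] with s hs N
    have hs : 0 < s := hs
    refine le_trans (le_of_eq ?_) (aux_antitone_var (fun i => ((i : ℝ) + 1) ^ (-s)) ?_ ?_ ?_ N)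
    · refine sum_congr rfl fun i _ => ?_
      rw [← Complex.ofReal_sub, Complex.norm_real, Real.norm_eq_abs]
    · intro i j hij
      have : (i : ℝ) ≤ j := by exact_mod_cast hij
      exact Real.rpow_le_rpow_of_nonpos (by positivity) (by linarith) (by linarith)
    · simp
    · intro i; positivity
  · intro i
    have : Continuous (fun s : ℝ => ((((i : ℝ) + 1) ^ (-s) : ℝ) : ℂ)) := by
      refine Complex.continuous_ofReal.comp ?_
      exact continuous_const.rpow continuous_neg (fun _ => Or.inl (by positivity))
    have := (this.tendsto 0).mono_left (nhdsWithin_le_nhds (s := Set.Ioi 0))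
    simpa using this
  · filter_upwards [self_mem_nhdsWithin] with s hs
    refine Summable.congr ((summable_nat_add_iff 1).2
      (DirichletCharacter.LSeriesSummable_of_one_lt_re χ (hre s hs))) fun i => ?_
    exact (hterm s hs i).symm
  · filter_upwards [self_mem_nhdsWithin] with s hs
    have h1 : Tendsto (fun i : ℕ => ((i : ℝ) + 1)) atTop atTop :=
      tendsto_atTop_add_const_right _ _ tendsto_natCast_atTop_atTop
    have := (tendsto_rpow_neg_atTop (show 0 < s from hs)).comp h1
    have := (Complex.continuous_ofReal.tendsto 0).comp this
    rw [Complex.ofReal_zero] at this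
    exact this

open Finset in
/-- The numerator divided by `1 - y`, over the denominator divided by `1 - y`. -/
noncomputable def auxG (q : ℕ) (c : ℕ → ℂ) (y : ℝ) : ℂ :=
  (-∑ n ∈ range q, c n * ∑ j ∈ range n, (y : ℂ) ^ j) / ((∑ j ∈ range q, y ^ j : ℝ) : ℂ)

open Finset in
theorem auxG_eq (q : ℕ) [NeZero q] (c : ℕ → ℂ) (hper : ∀ n, c (n + q) = c n) (hb : ∀ n, ‖c n‖ ≤ 1)
    (h0 : ∑ n ∈ range q, c n = 0) (y : ℝ) (hy : 0 ≤ y) (hy1 : y < 1) :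
    ∑' n, c n * (y : ℂ) ^ n = auxG q c y := by
  have hs : Summable (fun n => c n * (y : ℂ) ^ n) := by
    refine Summable.of_norm_bounded (summable_geometric_of_lt_one hy hy1) fun n => ?_
    rw [norm_mul, norm_pow, Complex.norm_real, Real.norm_of_nonneg hy]
    exact mul_le_of_le_one_left (by positivity) (hb n)
  have h1 := hs.sum_add_tsum_nat_add q
  have h2 : ∑' n, c (n + q) * (y : ℂ) ^ (n + q) = (∑' n, c n * (y : ℂ) ^ n) * (y:ℂ) ^ q := by
    rw [← tsum_mul_right]
    refine tsum_congr fun n => ?_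
    rw [hper, pow_add]; ring
  rw [h2] at h1
  set S := ∑' n, c n * (y : ℂ) ^ n
  have hD : (0:ℝ) < ∑ j ∈ range q, y ^ j := by
    obtain ⟨m, rfl⟩ : ∃ m, q = m + 1 := ⟨q - 1, by have := NeZero.ne q; omega⟩
    rw [sum_range_succ']
    have : 0 ≤ ∑ j ∈ range m, y ^ (j+1) := sum_nonneg fun _ _ => by positivity
    simp; linarith
  have hD' : ((∑ j ∈ range q, y ^ j : ℝ) : ℂ) ≠ 0 := by exact_mod_cast hD.ne'
  rw [auxG, eq_div_iff hD']
  have hne : (1 - y : ℂ) ≠ 0 := by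
    have : (1 - y : ℝ) ≠ 0 := by linarith
    exact_mod_cast this
  apply mul_right_cancel₀ hne
  have hg : ∀ n, (∑ j ∈ range n, (y : ℂ) ^ j) * (1 - y) = 1 - (y:ℂ) ^ n := fun n => by
    have := geom_sum_mul (y : ℂ) n
    linear_combination -this
  push_cast
  rw [mul_assoc, hg, neg_mul, sum_mul]
  have : ∀ n ∈ range q, c n * (∑ j ∈ range n, (y : ℂ) ^ j) * (1 - y) = c n - c n * (y : ℂ) ^ n := by
    intro n _
    rw [mul_assoc, hg]; ring
  rw [sum_congr rfl this, sum_sub_distrib, h0]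
  linear_combination -h1

open Finset in
theorem auxG_lip (q : ℕ) [NeZero q] (c : ℕ → ℂ) :
    ∃ K : ℝ, 0 ≤ K ∧ ∀ x ∈ Set.Icc (0:ℝ) 1, ∀ y ∈ Set.Icc (0:ℝ) 1,
      ‖auxG q c x - auxG q c y‖ ≤ K * |x - y| := by
  have hD : ∀ y ∈ Set.Icc (0:ℝ) 1, ((∑ j ∈ range q, y ^ j : ℝ) : ℂ) ≠ 0 := by
    intro y hy
    obtain ⟨m, rfl⟩ : ∃ m, q = m + 1 := ⟨q - 1, by have := NeZero.ne q; omega⟩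
    have : 0 ≤ ∑ j ∈ range m, y ^ (j+1) := sum_nonneg fun _ _ => pow_nonneg hy.1 _
    have h : ∑ j ∈ range (m+1), y ^ j ≠ 0 := by
      rw [sum_range_succ']
      simp; linarith
    exact_mod_cast h
  have hof : ContDiff ℝ 1 (fun y : ℝ => (y : ℂ)) := Complex.ofRealCLM.contDiff
  have hcd : ContDiffOn ℝ 1 (auxG q c) (Set.Icc 0 1) := by
    unfold auxG
    simp only [div_eq_mul_inv]
    refine ContDiffOn.mul ?_ (ContDiffOn.inv ?_ hD)
    · refine ContDiff.contDiffOn ?_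
      fun_prop
    · push_cast
      refine ContDiff.contDiffOn ?_
      fun_prop
  have hu : UniqueDiffOn ℝ (Set.Icc (0:ℝ) 1) := uniqueDiffOn_Icc one_pos
  have hc := hcd.continuousOn_derivWithin hu le_rfl
  obtain ⟨K, hK⟩ := isCompact_Icc.exists_bound_of_continuousOn hc
  have hK0 : 0 ≤ K := (norm_nonneg _).trans (hK 0 (by simp))
  refine ⟨K, hK0, fun x hx y hy => ?_⟩
  have := (convex_Icc (0:ℝ) 1).norm_image_sub_le_of_norm_derivWithin_le
    (hcd.differentiableOn one_ne_zero) hK hy hx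
  simpa using this

theorem aux_ne_one {q : ℕ} [NeZero q] (hq : 1 < q) (χ : DirichletCharacter ℂ q)
    (h : χ.IsPrimitive) : χ ≠ 1 := by
  rintro rfl
  rw [DirichletCharacter.IsPrimitive, DirichletCharacter.conductor_one] at h
  omega

open Filter Topology Finset in
theorem f_limit_at_zero
    {q₁ q₂ : ℕ} [NeZero q₁] (hq₁ : 1 < q₁) (hq₂ : 1 < q₂)
    (χ₁ : DirichletCharacter ℂ q₁) (χ₂ : DirichletCharacter ℂ q₂)
    (hχ₁ : χ₁.IsPrimitive) (hχ₂ : χ₂.IsPrimitive)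
    (hpar : χ₁ (-1) * χ₂ (-1) = 1) :
    Filter.Tendsto (fun u : ℝ => fE χ₁ χ₂ (Complex.I * (u : ℂ)))
      (nhdsWithin 0 (Set.Ioi 0))
      (nhds (-(DirichletCharacter.LFunction χ₁ 1) *
        ∑ n ∈ Finset.Ico 1 q₂,
          (starRingEnd ℂ) (χ₂ ((n : ℕ) : ZMod q₂)) * (B1 ((n : ℝ) / (q₂ : ℝ)) : ℂ))) := by
  have : NeZero q₂ := ⟨by omega⟩
  have : Fact (1 < q₂) := ⟨hq₂⟩
  set c : ℕ → ℂ := fun n => (starRingEnd ℂ) (χ₂ (n : ZMod q₂)) with hcdef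
  have hc0 : c 0 = 0 := by simp [hcdef, MulChar.map_nonunit]
  have hper : ∀ n, c (n + q₂) = c n := by intro n; simp [hcdef]
  have hcb : ∀ n, ‖c n‖ ≤ 1 := by
    intro n
    simp only [hcdef, RCLike.norm_conj]
    exact χ₂.norm_le_one _
  have hcs : ∑ n ∈ range q₂, c n = 0 := by
    rw [hcdef, aux_sum_range (fun x => (starRingEnd ℂ) (χ₂ x)), ← map_sum,
      MulChar.sum_eq_zero_of_ne_one (aux_ne_one hq₂ χ₂ hχ₂), map_zero]
  obtain ⟨K, hK0, hK⟩ := auxG_lip q₂ c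
  have hG0 : auxG q₂ c 0 = 0 := by
    rw [← auxG_eq q₂ c hper hcb hcs 0 le_rfl one_pos, tsum_eq_single 0]
    · simp [hc0]
    · intro n hn; simp [hn]
  have hG1 : auxG q₂ c 1 = -∑ n ∈ Finset.Ico 1 q₂, c n * (B1 ((n : ℝ) / (q₂ : ℝ)) : ℂ) := by
    have h1 : ∑ n ∈ Finset.Ico 1 q₂, c n * (B1 ((n : ℝ) / (q₂ : ℝ)) : ℂ)
        = ∑ n ∈ range q₂, c n * ((n : ℂ) / q₂ - 1 / 2) := by
      rw [range_eq_Ico, sum_eq_sum_Ico_succ_bot (by omega : 0 < q₂), hc0, zero_mul, zero_add]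
      refine sum_congr rfl fun n hn => ?_
      rw [mem_Ico] at hn
      have hq : (0:ℝ) < q₂ := by exact_mod_cast (by omega : 0 < q₂)
      have hn0 : (0:ℝ) < n := by exact_mod_cast (by omega : 0 < n)
      have hf : Int.fract ((n : ℝ) / q₂) = n / q₂ := by
        rw [Int.fract_eq_self]
        refine ⟨by positivity, (div_lt_one hq).2 (by exact_mod_cast hn.2)⟩
      rw [B1, hf, if_neg (by positivity)]
      push_cast; rfl
    rw [h1, auxG]
    simp only [mul_sub, sum_sub_distrib, ← sum_mul, hcs]
    simp [neg_div, sum_div, mul_div_assoc]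
  set y : ℝ → ℕ → ℝ := fun u l => Real.exp (-(2 * Real.pi * u)) ^ (l+1) with hy
  have hr : ∀ u : ℝ, 0 < u → Real.exp (-(2 * Real.pi * u)) < 1 := by
    intro u hu
    rw [Real.exp_lt_one_iff]
    have := Real.pi_pos
    have : 0 < 2 * Real.pi * u := by positivity
    linarith
  have hy1 : ∀ u : ℝ, 0 < u → ∀ l, 0 ≤ y u l ∧ y u l < 1 := by
    intro u hu l
    exact ⟨by positivity, pow_lt_one₀ (Real.exp_pos _).le (hr u hu) (by omega)⟩
  have hyI : ∀ u : ℝ, 0 < u → ∀ l, y u l ∈ Set.Icc (0:ℝ) 1 := 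
    fun u hu l => ⟨(hy1 u hu l).1, (hy1 u hu l).2.le⟩
  have hGb : ∀ u : ℝ, 0 < u → ∀ l, ‖auxG q₂ c (y u l)‖ ≤ K * y u l := by
    intro u hu l
    have := hK (y u l) (hyI u hu l) 0 (by simp)
    rwa [hG0, sub_zero, sub_zero, abs_of_nonneg (hy1 u hu l).1] at this
  have hysum : ∀ u : ℝ, 0 < u → Summable (fun l => K * y u l) := by
    intro u hu
    exact (((summable_nat_add_iff 1).2
      (summable_geometric_of_lt_one (Real.exp_pos _).le (hr u hu)))).mul_left K
  have hf : ∀ u : ℝ, 0 < u → fE χ₁ χ₂ (Complex.I * (u : ℂ)) =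
      ∑' l : ℕ, χ₁ ((l+1 : ℕ) : ZMod q₁) / ((l+1 : ℕ) : ℂ) * auxG q₂ c (y u l) := by
    intro u hu
    rw [fE, ← tsum_pnat_eq_tsum_succ (f := fun l : ℕ => χ₁ ((l : ℕ) : ZMod q₁) / ((l : ℕ) : ℂ) *
      auxG q₂ c (Real.exp (-(2 * Real.pi * u)) ^ l))]
    refine tsum_congr fun l => ?_
    rw [← auxG_eq q₂ c hper hcb hcs _ (by positivity)
      (pow_lt_one₀ (Real.exp_pos _).le (hr u hu) l.ne_zero),
      ← tsum_pnat_eq_tsum_of_eq_zero (by simp [hc0]), ← tsum_mul_left]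
    refine tsum_congr fun k => ?_
    have : eC ((k : ℂ) * (l : ℂ) * (Complex.I * u))
        = (((Real.exp (-(2 * Real.pi * u)) ^ (l:ℕ) : ℝ)) : ℂ) ^ (k : ℕ) := by
      rw [eC]
      push_cast
      rw [← pow_mul, ← Complex.exp_nat_mul]
      congr 1
      push_cast
      linear_combination (2 * Real.pi * k * l * u) * Complex.I_sq
    rw [this]
    simp only [hcdef]
    ring
  have hT := aux_toeplitz (F := 𝓝[>] (0:ℝ)) _ _ (auxG q₂ c 1)
    (fun u l => auxG q₂ c (y u l)) K (aux_L χ₁ (aux_ne_one hq₁ χ₁ hχ₁)) ?_ ?_ ?_ ?_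
  · rw [hG1, mul_neg, ← neg_mul] at hT
    refine hT.congr' ?_
    filter_upwards [self_mem_nhdsWithin] with u hu
    exact (hf u hu).symm
  · filter_upwards [self_mem_nhdsWithin] with u hu N
    have hu : 0 < u := hu
    calc _ ≤ ∑ i ∈ range N, K * |y u i - y u (i+1)| :=
          sum_le_sum fun i _ => hK _ (hyI u hu _) _ (hyI u hu _)
      _ ≤ K * 1 := by
          rw [← mul_sum]
          refine mul_le_mul_of_nonneg_left (aux_antitone_var (y u) ?_ (hy1 u hu 0).2.le
            (fun i => (hy1 u hu i).1) N) hK0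
          intro i j hij
          exact pow_le_pow_of_le_one (Real.exp_pos _).le (hr u hu).le (by omega)
      _ = K := mul_one K
  · intro i
    have hyc : Tendsto (fun u => K * |y u i - 1|) (𝓝[>] 0) (𝓝 0) := by
      have : Continuous (fun u => K * |y u i - 1|) := by simp only [hy]; fun_prop
      have := (this.tendsto 0).mono_left (nhdsWithin_le_nhds (s := Set.Ioi 0))
      simpa [hy] using this
    rw [tendsto_iff_norm_sub_tendsto_zero]
    refine tendsto_of_tendsto_of_tendsto_of_le_of_le' tendsto_const_nhds hyc
      (Eventually.of_forall fun _ => norm_nonneg _) ?_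
    filter_upwards [self_mem_nhdsWithin] with u hu
    exact hK _ (hyI u hu _) 1 (by simp)
  · filter_upwards [self_mem_nhdsWithin] with u hu
    refine Summable.of_norm_bounded (hysum u hu) fun l => ?_
    rw [norm_mul, norm_div]
    refine (mul_le_of_le_one_left (norm_nonneg _) ?_).trans (hGb u hu l)
    rw [Complex.norm_natCast]
    refine div_le_one_of_le₀ ((χ₁.norm_le_one _).trans ?_) (by positivity)
    exact_mod_cast Nat.succ_pos l
  · filter_upwards [self_mem_nhdsWithin] with u hu
    exact squeeze_zero_norm (hGb u hu) (hysum u hu).tendsto_atTop_zero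
end

section
/- Let χ₁, χ₂ be primitive Dirichlet characters of conductors q₁, q₂ respectively, with q₁, q₂ > 1 and χ₁(−1)χ₂(−1) = 1. If χ₁ and χ₂ are both even (χ₁(−1) = χ₂(−1) = 1), then f_{χ₁,χ₂}(iu) → 0 as u → 0 from the right. If χ₁ and χ₂ are both odd (χ₁(−1) = χ₂(−1) = −1), then as u → 0 from the right, f_{χ₁,χ₂}(iu) tends to (τ(conj(χ₂))/(πi)) · L(1,χ₁) · L(1,χ₂). -/
open Complex

open Filter Topology Finset

lemma toeplitz_aux {ι : Type*} {F : Filter ι} (a : ℕ → ℂ) (S : ℂ)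
    (hA : Tendsto (fun n => ∑ i ∈ range n, a i) atTop (𝓝 S))
    (φ : ι → ℕ → ℂ) (C : ℝ)
    (hvar : ∀ᶠ u in F, ∀ n, ∑ i ∈ range n, ‖φ u i - φ u (i+1)‖ ≤ C)
    (h0 : ∀ᶠ u in F, Tendsto (φ u) atTop (𝓝 0))
    (hsum : ∀ᶠ u in F, Summable fun n => a n * φ u n)
    (c : ℂ) (hc : ∀ n, Tendsto (fun u => φ u n) F (𝓝 c)) :
    Tendsto (fun u => ∑' n, a n * φ u n) F (𝓝 (S * c)) := by
  set A : ℕ → ℂ := fun n => ∑ i ∈ range n, a i with hAdef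
  have key : ∀ u n, ∑ i ∈ range n, a i * φ u i = S * φ u 0 + (A n - S) * φ u n
      + ∑ i ∈ range n, (A (i+1) - S) * (φ u i - φ u (i+1)) := by
    intro u n
    induction n with
    | zero => simp [hAdef]
    | succ n ih =>
      rw [sum_range_succ, ih, sum_range_succ]
      have : A (n+1) = A n + a n := by simp [hAdef, sum_range_succ]
      rw [this]; ring
  have hA0 : Tendsto (fun n => A (n+1) - S) atTop (𝓝 0) := by
    have := (hA.comp (tendsto_add_atTop_nat 1)).sub_const S
    simpa using this
  have hA1 : Tendsto (fun n => A n - S) atTop (𝓝 0) := by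
    have := hA.sub_const S
    simpa using this
  have bound : ∀ ε > 0, ∃ N, ∀ᶠ u in F, ‖(∑' n, a n * φ u n) - S * φ u 0‖ ≤
      ∑ i ∈ range N, ‖A (i+1) - S‖ * ‖φ u i - φ u (i+1)‖ + ε * C := by
    intro ε hε
    obtain ⟨N, hN⟩ := (Metric.tendsto_atTop.1 hA0) ε hε
    refine ⟨N, ?_⟩
    filter_upwards [hvar, h0, hsum] with u hv h0 hs
    have t1 : Tendsto (fun n => ∑ i ∈ range n, a i * φ u i - S * φ u 0 - (A n - S) * φ u n) atTop
        (𝓝 ((∑' n, a n * φ u n) - S * φ u 0 - 0 * 0)) :=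
      (hs.hasSum.tendsto_sum_nat.sub_const _).sub (hA1.mul h0)
    rw [mul_zero, sub_zero] at t1
    refine le_of_tendsto t1.norm ?_
    filter_upwards [eventually_ge_atTop N] with n hn
    have : ∑ i ∈ range n, a i * φ u i - S * φ u 0 - (A n - S) * φ u n =
      ∑ i ∈ range n, (A (i+1) - S) * (φ u i - φ u (i+1)) := by rw [key]; ring
    rw [this]
    refine (norm_sum_le _ _).trans ?_
    simp_rw [norm_mul]
    rw [← sum_range_add_sum_Ico _ hn]
    gcongr
    calc ∑ i ∈ Ico N n, ‖A (i+1) - S‖ * ‖φ u i - φ u (i+1)‖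
        ≤ ∑ i ∈ Ico N n, ε * ‖φ u i - φ u (i+1)‖ := by
          refine sum_le_sum fun i hi => ?_
          have := hN i (mem_Ico.1 hi).1
          rw [dist_zero_right] at this
          gcongr
      _ = ε * ∑ i ∈ Ico N n, ‖φ u i - φ u (i+1)‖ := by rw [mul_sum]
      _ ≤ ε * ∑ i ∈ range n, ‖φ u i - φ u (i+1)‖ := by
          gcongr
          intro i hi
          simp at hi ⊢; omega
      _ ≤ ε * C := by gcongr; exact hv n
  have lim0 : Tendsto (fun u => (∑' n, a n * φ u n) - S * φ u 0) F (𝓝 0) := by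
    rw [Metric.tendsto_nhds]
    intro ε hε
    obtain ⟨N, hN⟩ := bound (ε / (2 * (|C| + 1))) (by positivity)
    have hD : Tendsto (fun u => ∑ i ∈ range N, ‖A (i+1) - S‖ * ‖φ u i - φ u (i+1)‖) F (𝓝 0) := by
      have : Tendsto (fun u => ∑ i ∈ range N, ‖A (i+1) - S‖ * ‖φ u i - φ u (i+1)‖) F
          (𝓝 (∑ i ∈ range N, ‖A (i+1) - S‖ * ‖c - c‖)) :=
        tendsto_finsetSum _ fun i _ => (((hc i).sub (hc (i+1))).norm).const_mul _
      simpa using this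
    have hD' := (hD.eventually_lt_const (show (0:ℝ) < ε/2 by positivity))
    filter_upwards [hN, hD'] with u h1 h2
    rw [dist_zero_right]
    have : ε / (2 * (|C| + 1)) * C ≤ ε / 2 := by
      calc ε / (2 * (|C| + 1)) * C ≤ ε / (2 * (|C| + 1)) * (|C| + 1) := by
            gcongr; linarith [le_abs_self C]
        _ = ε / 2 := by field_simp
    linarith
  have := lim0.add ((hc 0).const_mul S)
  simpa using this

/-- Weights controlled by an antitone sequence in `[0,1]`. -/
lemma toeplitz_mono {ι : Type*} {F : Filter ι} (a : ℕ → ℂ) (S : ℂ)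
    (hA : Tendsto (fun n => ∑ i ∈ range n, a i) atTop (𝓝 S))
    (φ : ι → ℕ → ℂ) (m : ι → ℕ → ℝ) (K : ℝ) (hK : 0 ≤ K)
    (hm : ∀ᶠ u in F, ∀ n, 0 ≤ m u n ∧ m u n ≤ 1)
    (hvar : ∀ᶠ u in F, ∀ i, ‖φ u i - φ u (i+1)‖ ≤ K * (m u i - m u (i+1)))
    (h0 : ∀ᶠ u in F, Tendsto (φ u) atTop (𝓝 0))
    (hsum : ∀ᶠ u in F, Summable fun n => a n * φ u n)
    (c : ℂ) (hc : ∀ n, Tendsto (fun u => φ u n) F (𝓝 c)) :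
    Tendsto (fun u => ∑' n, a n * φ u n) F (𝓝 (S * c)) := by
  refine toeplitz_aux a S hA φ K ?_ h0 hsum c hc
  filter_upwards [hm, hvar] with u hm hv n
  calc ∑ i ∈ range n, ‖φ u i - φ u (i+1)‖ ≤ ∑ i ∈ range n, K * (m u i - m u (i+1)) :=
        sum_le_sum fun i _ => hv i
    _ = K * (m u 0 - m u n) := by rw [← mul_sum, sum_range_sub']
    _ ≤ K * 1 := by
        gcongr
        linarith [(hm 0).2, (hm n).1]
    _ = K := mul_one K

lemma sum_zmod_eq_range {q : ℕ} [NeZero q] (g : ZMod q → ℂ) :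
    ∑ j : ZMod q, g j = ∑ i ∈ range q, g (i : ZMod q) := by
  refine Finset.sum_nbij' (fun j => j.val) (fun i => (i : ZMod q)) ?_ ?_ ?_ ?_ ?_
  · intro j _; simpa using ZMod.val_lt j
  · intro i _; simp
  · intro j _; simp
  · intro i hi; exact ZMod.val_cast_of_lt (by simpa using hi)
  · intro j _; simp

lemma char_zero {q : ℕ} (hq : 1 < q) (χ : DirichletCharacter ℂ q) : χ 0 = 0 := by
  have : Fact (1 < q) := ⟨hq⟩
  exact MulChar.map_nonunit χ not_isUnit_zero

lemma sum_range_char {q : ℕ} [NeZero q] {χ : DirichletCharacter ℂ q} (hχ : χ ≠ 1) :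
    ∑ i ∈ range q, χ (i : ZMod q) = 0 := by
  rw [← sum_zmod_eq_range]
  exact MulChar.sum_eq_zero_of_ne_one hχ

lemma char_partial_bounded {q : ℕ} [NeZero q] (hq : 1 < q) {χ : DirichletCharacter ℂ q}
    (hχ : χ ≠ 1) :
    ∃ b : ℝ, ∀ n : ℕ, ‖∑ i ∈ range n, χ ((i + 1 : ℕ) : ZMod q)‖ ≤ b := by
  set P : ℕ → ℂ := fun n => ∑ i ∈ range n, χ (i : ZMod q) with hP
  have hper : Function.Periodic P q := by
    intro n
    simp only [hP]
    rw [add_comm n q, sum_range_add, sum_range_char hχ, zero_add]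
    simp
  refine ⟨∑ k ∈ range q, ‖P k‖, fun n => ?_⟩
  have h1 : ∑ i ∈ range n, χ ((i + 1 : ℕ) : ZMod q) = P (n + 1) := by
    simp only [hP]
    rw [sum_range_succ']
    simp [char_zero hq χ]
  rw [h1, ← hper.map_mod_nat]
  exact single_le_sum (f := fun k => ‖P k‖) (fun _ _ => norm_nonneg _)
    (mem_range.2 (Nat.mod_lt _ (by omega)))

lemma partial_tendsto_L1 {q : ℕ} [NeZero q] (hq : 1 < q) {χ : DirichletCharacter ℂ q}
    (hχ : χ ≠ 1) :
    Tendsto (fun n => ∑ i ∈ range n, χ ((i + 1 : ℕ) : ZMod q) / ((i + 1 : ℕ) : ℂ)) atTop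
      (𝓝 (DirichletCharacter.LFunction χ 1)) := by
  obtain ⟨b, hb⟩ := char_partial_bounded hq hχ
  have hanti : Antitone (fun n : ℕ => 1 / ((n : ℝ) + 1)) := by
    intro m n hmn
    simp only
    gcongr
  have hcau := hanti.cauchySeq_series_mul_of_tendsto_zero_of_bounded
    tendsto_one_div_add_atTop_nhds_zero_nat hb
  obtain ⟨S, hS⟩ := cauchySeq_tendsto_of_complete hcau
  have hS' : Tendsto (fun n => ∑ i ∈ range n, χ ((i + 1 : ℕ) : ZMod q) / ((i + 1 : ℕ) : ℂ)) atTop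
      (𝓝 S) := by
    refine hS.congr fun n => sum_congr rfl fun i _ => ?_
    rw [Complex.real_smul]
    push_cast
    ring
  suffices DirichletCharacter.LFunction χ 1 = S by rwa [this]
  have hterm : ∀ s : ℝ, ∀ n : ℕ, χ ((n + 1 : ℕ) : ZMod q) / ((n + 1 : ℕ) : ℂ) *
      (((n + 1 : ℝ) ^ (-s) : ℝ) : ℂ) = LSeries.term (χ ·) (1 + s) (n + 1) := by
    intro s n
    rw [LSeries.term_of_ne_zero (by omega)]
    have hn : ((n + 1 : ℕ) : ℂ) ≠ 0 := by exact_mod_cast Nat.succ_ne_zero n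
    rw [Complex.cpow_add _ _ hn, Complex.cpow_one, Complex.ofReal_cpow (by positivity)]
    push_cast
    rw [Complex.cpow_neg]
    field_simp
  have hsumm : ∀ s : ℝ, 0 < s → Summable (fun n => LSeries.term (χ ·) (1 + s) n) := by
    intro s hs
    exact ZMod.LSeriesSummable_of_one_lt_re χ (by simpa using hs)
  have hm : ∀ s : ℝ, 0 < s → ∀ n : ℕ, ((n:ℝ) + 1 + 1) ^ (-s) ≤ ((n:ℝ) + 1) ^ (-s) := by
    intro s hs n
    exact Real.rpow_le_rpow_of_nonpos (by positivity) (by linarith) (by linarith)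
  have lim := toeplitz_mono (F := 𝓝[>] (0:ℝ)) _ S hS'
    (fun s n => (((n + 1 : ℝ) ^ (-s) : ℝ) : ℂ)) (fun s n => (n + 1 : ℝ) ^ (-s)) 1 zero_le_one
    (by
      filter_upwards [self_mem_nhdsWithin] with s hs n
      have hs : 0 < s := hs
      refine ⟨by positivity, Real.rpow_le_one_of_one_le_of_nonpos ?_ (by linarith)⟩
      have : (0:ℝ) ≤ n := by positivity
      linarith)
    (by
      filter_upwards [self_mem_nhdsWithin] with s hs n
      rw [one_mul, ← Complex.ofReal_sub, Complex.norm_real, Real.norm_eq_abs, abs_of_nonneg]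
      have := hm s hs n
      push_cast
      linarith)
    (by
      filter_upwards [self_mem_nhdsWithin] with s hs
      have h1 : Tendsto (fun n : ℕ => ((n : ℝ) + 1)) atTop atTop :=
        tendsto_atTop_add_const_right _ _ tendsto_natCast_atTop_atTop
      have h2 := (tendsto_rpow_neg_atTop hs).comp h1
      have := (Complex.continuous_ofReal.tendsto 0).comp h2
      simpa using! this)
    (by
      filter_upwards [self_mem_nhdsWithin] with s hs
      simp_rw [hterm]
      exact (summable_nat_add_iff 1).2 (hsumm s hs))
    1
    (by
      intro n
      have : ContinuousAt (fun s : ℝ => (((n + 1 : ℝ) ^ (-s) : ℝ) : ℂ)) 0 := by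
        refine Complex.continuous_ofReal.continuousAt.comp ?_
        exact ContinuousAt.rpow continuousAt_const continuousAt_neg (Or.inl (by positivity))
      have := this.tendsto.mono_left (nhdsWithin_le_nhds (s := Set.Ioi 0))
      simpa using this)
  rw [mul_one] at lim
  have lim2 : Tendsto (fun s : ℝ => DirichletCharacter.LFunction χ (1 + s)) (𝓝[>] (0:ℝ))
      (𝓝 (DirichletCharacter.LFunction χ 1)) := by
    have h : Continuous (fun s : ℝ => DirichletCharacter.LFunction χ (1 + s)) :=
      (DirichletCharacter.differentiable_LFunction hχ).continuous.comp (by fun_prop)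
    have := (h.tendsto 0).mono_left (nhdsWithin_le_nhds (s := Set.Ioi 0))
    simpa using this
  refine tendsto_nhds_unique lim2 (lim.congr' ?_)
  filter_upwards [self_mem_nhdsWithin] with s hs
  rw [DirichletCharacter.LFunction_eq_LSeries χ (by simpa using hs), LSeries,
    (hsumm s hs).tsum_eq_zero_add]
  simp_rw [hterm]
  simp

/-- The generating function of a character as a rational function. -/
noncomputable def hfun {q : ℕ} (ψ : DirichletCharacter ℂ q) (x : ℝ) : ℂ :=
  (-∑ k ∈ range q, ψ (k : ZMod q) * ∑ j ∈ range k, (x : ℂ) ^ j) / ∑ j ∈ range q, (x : ℂ) ^ j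

lemma geom_ne_zero {q : ℕ} (hq : 1 < q) {x : ℝ} (hx : 0 ≤ x) :
    ∑ j ∈ range q, (x : ℂ) ^ j ≠ 0 := by
  have : 0 < ∑ j ∈ range q, x ^ j := by
    refine sum_pos' (fun i _ => by positivity) ⟨0, by simp; omega, by simp⟩
  have h := Complex.ofReal_ne_zero.2 this.ne'
  push_cast at h
  exact h

lemma summable_char_pow {q : ℕ} (ψ : DirichletCharacter ℂ q) {x : ℝ} (hx : 0 ≤ x) (hx1 : x < 1) :
    Summable (fun k : ℕ => ψ (k : ZMod q) * (x : ℂ) ^ k) := by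
  refine Summable.of_norm_bounded (summable_geometric_of_lt_one hx hx1) fun k => ?_
  rw [norm_mul, norm_pow, Complex.norm_real, Real.norm_of_nonneg hx]
  exact mul_le_of_le_one_left (by positivity) (ψ.norm_le_one _)

lemma tsum_char_pow {q : ℕ} [NeZero q] (hq : 1 < q) {ψ : DirichletCharacter ℂ q} (hψ : ψ ≠ 1)
    {x : ℝ} (hx : 0 ≤ x) (hx1 : x < 1) :
    ∑' k : ℕ, ψ (k : ZMod q) * (x : ℂ) ^ k = hfun ψ x := by
  have hs := summable_char_pow ψ hx hx1
  have h1 := hs.sum_add_tsum_nat_add q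
  have h2 : ∑' k : ℕ, ψ ((k + q : ℕ) : ZMod q) * (x : ℂ) ^ (k + q)
      = (x : ℂ) ^ q * ∑' k : ℕ, ψ (k : ZMod q) * (x : ℂ) ^ k := by
    rw [← tsum_mul_left]
    refine tsum_congr fun k => ?_
    push_cast
    rw [ZMod.natCast_self, add_zero]
    ring
  rw [h2] at h1
  set T := ∑' k : ℕ, ψ (k : ZMod q) * (x : ℂ) ^ k
  have h3 : ∑ k ∈ range q, ψ (k : ZMod q) * (x : ℂ) ^ k
      = (∑ k ∈ range q, ψ (k : ZMod q) * ∑ j ∈ range k, (x : ℂ) ^ j) * (x - 1) := by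
    rw [sum_mul]
    simp_rw [mul_assoc, geom_sum_mul, mul_sub, mul_one]
    rw [sum_sub_distrib, sum_range_char hψ, sub_zero]
  have h4 := geom_sum_mul (x : ℂ) q
  have h5 : (x : ℂ) - 1 ≠ 0 := by
    rw [sub_ne_zero]
    exact_mod_cast hx1.ne
  rw [hfun, eq_div_iff (geom_ne_zero hq hx)]
  apply mul_right_cancel₀ h5
  rw [h3] at h1
  linear_combination T * h4 + h1

lemma hfun_zero {q : ℕ} [NeZero q] (hq : 1 < q) {ψ : DirichletCharacter ℂ q} (hψ : ψ ≠ 1) :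
    hfun ψ 0 = 0 := by
  rw [← tsum_char_pow hq hψ le_rfl zero_lt_one]
  rw [tsum_eq_single 0]
  · simp [char_zero hq]
  · intro k hk
    simp [hk]

lemma hfun_one {q : ℕ} [NeZero q] (ψ : DirichletCharacter ℂ q) :
    hfun ψ 1 = -(∑ k ∈ range q, ψ (k : ZMod q) * k) / q := by
  simp [hfun]

lemma hfun_lip {q : ℕ} (hq : 1 < q) (ψ : DirichletCharacter ℂ q) :
    ∃ K : NNReal, LipschitzOnWith K (hfun ψ) (Set.Icc 0 1) := by
  refine LocallyLipschitzOn.exists_lipschitzOnWith_of_compact isCompact_Icc ?_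
  refine ContDiffOn.locallyLipschitzOn (convex_Icc 0 1) ?_
  have hof : ContDiff ℝ 1 (fun x : ℝ => (x : ℂ)) :=
    Complex.ofRealCLM.contDiff
  unfold hfun
  simp_rw [div_eq_mul_inv]
  refine ContDiffOn.mul ?_ (ContDiffOn.inv ?_ ?_)
  · refine ContDiff.contDiffOn ?_
    refine ContDiff.neg ?_
    refine ContDiff.sum fun k _ => ?_
    refine ContDiff.mul contDiff_const ?_
    exact ContDiff.sum fun j _ => hof.pow _
  · refine ContDiff.contDiffOn ?_
    exact ContDiff.sum fun j _ => hof.pow _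
  · intro x hx
    exact geom_ne_zero hq hx.1

lemma fE_eq {q₁ q₂ : ℕ} [NeZero q₂] (hq₂ : 1 < q₂)
    (χ₁ : DirichletCharacter ℂ q₁) (χ₂ : DirichletCharacter ℂ q₂) (hψ : χ₂⁻¹ ≠ 1)
    {u : ℝ} (hu : 0 < u) :
    fE χ₁ χ₂ (Complex.I * (u : ℂ)) =
      ∑' n : ℕ, χ₁ ((n + 1 : ℕ) : ZMod q₁) / ((n + 1 : ℕ) : ℂ) *
        hfun χ₂⁻¹ (Real.exp (-(2 * Real.pi * u)) ^ (n + 1)) := by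
  set w : ℝ := Real.exp (-(2 * Real.pi * u)) with hw
  have hw0 : 0 < w := Real.exp_pos _
  have hw1 : w < 1 := by
    rw [hw, Real.exp_lt_one_iff]
    have := Real.pi_pos
    have : 0 < 2 * Real.pi * u := by positivity
    linarith
  rw [← tsum_pnat_eq_tsum_succ (f := fun n : ℕ => χ₁ ((n : ℕ) : ZMod q₁) / ((n : ℕ) : ℂ) *
        hfun χ₂⁻¹ (w ^ n)), fE]
  refine tsum_congr fun l => ?_
  have hl : w ^ (l : ℕ) < 1 := pow_lt_one₀ hw0.le hw1 l.pos.ne'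
  rw [← tsum_char_pow hq₂ hψ (by positivity) hl,
    (summable_char_pow χ₂⁻¹ (by positivity) hl).tsum_eq_zero_add,
    ← tsum_pnat_eq_tsum_succ (f := fun k : ℕ => χ₂⁻¹ (k : ZMod q₂) * ((w ^ (l : ℕ) : ℝ) : ℂ) ^ k)]
  simp only [Nat.cast_zero, char_zero hq₂, zero_mul, zero_add]
  rw [← tsum_mul_left]
  refine tsum_congr fun k => ?_
  have he : eC ((k : ℂ) * (l : ℂ) * (Complex.I * u)) = ((w ^ (l : ℕ) : ℝ) : ℂ) ^ (k : ℕ) := by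
    rw [eC, hw]
    push_cast
    rw [← pow_mul, ← Complex.exp_nat_mul]
    congr 1
    push_cast
    linear_combination (2 * (Real.pi : ℂ) * k * l * u) * Complex.I_mul_I
  have hst : (starRingEnd ℂ) (χ₂ ((k : ℕ) : ZMod q₂)) = χ₂⁻¹ ((k : ℕ) : ZMod q₂) :=
    MulChar.star_apply' χ₂ _
  rw [he, hst]
  ring

lemma fE_tendsto {q₁ q₂ : ℕ} [NeZero q₁] [NeZero q₂] (hq₁ : 1 < q₁) (hq₂ : 1 < q₂)
    {χ₁ : DirichletCharacter ℂ q₁} {χ₂ : DirichletCharacter ℂ q₂} (h₁ : χ₁ ≠ 1) (hψ : χ₂⁻¹ ≠ 1) :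
    Tendsto (fun u : ℝ => fE χ₁ χ₂ (Complex.I * (u : ℂ))) (𝓝[>] 0)
      (𝓝 (DirichletCharacter.LFunction χ₁ 1 * hfun χ₂⁻¹ 1)) := by
  obtain ⟨K, hK⟩ := hfun_lip hq₂ χ₂⁻¹
  set w : ℝ → ℝ := fun u => Real.exp (-(2 * Real.pi * u)) with hw
  have hw0 : ∀ u, 0 < w u := fun u => Real.exp_pos _
  have hw1 : ∀ u, 0 < u → w u < 1 := by
    intro u hu
    simp only [hw]
    rw [Real.exp_lt_one_iff]
    have := Real.pi_pos
    have : 0 < 2 * Real.pi * u := by positivity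
    linarith
  have hmem : ∀ u, 0 < u → ∀ n : ℕ, w u ^ n ∈ Set.Icc (0:ℝ) 1 := fun u hu n =>
    ⟨by have := hw0 u; positivity, pow_le_one₀ (hw0 u).le (hw1 u hu).le⟩
  have hdecay : ∀ u, 0 < u → ∀ n : ℕ, ‖hfun χ₂⁻¹ (w u ^ n)‖ ≤ K * w u ^ n := by
    intro u hu n
    have := hK.dist_le_mul _ (hmem u hu n) 0 (by simp)
    rw [hfun_zero hq₂ hψ, dist_zero_right, dist_zero_right,
      Real.norm_of_nonneg (hmem u hu n).1] at this
    exact this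
  have hgeo : ∀ u, 0 < u → Summable (fun n : ℕ => (K:ℝ) * w u ^ (n + 1)) := fun u hu =>
    ((summable_nat_add_iff 1).2 (summable_geometric_of_lt_one (hw0 u).le (hw1 u hu))).mul_left _
  refine (toeplitz_mono (F := 𝓝[>] (0:ℝ)) _ _ (partial_tendsto_L1 hq₁ h₁)
    (fun u n => hfun χ₂⁻¹ (w u ^ (n + 1))) (fun u n => w u ^ (n + 1)) K K.2
    ?_ ?_ ?_ ?_ (hfun χ₂⁻¹ 1) ?_).congr' ?_
  · filter_upwards [self_mem_nhdsWithin] with u hu n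
    exact hmem u hu _
  · filter_upwards [self_mem_nhdsWithin] with u hu n
    have := hK.dist_le_mul _ (hmem u hu (n + 1)) _ (hmem u hu (n + 1 + 1))
    rw [dist_eq_norm, Real.dist_eq, abs_of_nonneg] at this
    · exact this
    · rw [sub_nonneg]
      exact pow_le_pow_of_le_one (hw0 u).le (hw1 u hu).le (by omega)
  · filter_upwards [self_mem_nhdsWithin] with u hu
    exact squeeze_zero_norm (fun n => hdecay u hu (n + 1)) (hgeo u hu).tendsto_atTop_zero
  · filter_upwards [self_mem_nhdsWithin] with u hu
    refine Summable.of_norm_bounded (hgeo u hu) fun n => ?_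
    rw [norm_mul]
    refine (mul_le_of_le_one_left (norm_nonneg _) ?_).trans (hdecay u hu (n + 1))
    rw [norm_div, Complex.norm_natCast]
    refine div_le_one_of_le₀ ((χ₁.norm_le_one _).trans ?_) (by positivity)
    push_cast
    have : (0:ℝ) ≤ n := by positivity
    linarith
  · intro n
    have hc : ContinuousWithinAt (hfun χ₂⁻¹) (Set.Icc 0 1) 1 :=
      hK.continuousOn 1 (by simp)
    refine hc.tendsto.comp (tendsto_nhdsWithin_iff.2 ⟨?_, ?_⟩)
    · have : Continuous fun u : ℝ => w u ^ (n + 1) := by fun_prop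
      have := (this.tendsto 0).mono_left (nhdsWithin_le_nhds (s := Set.Ioi 0))
      simpa [hw] using this
    · filter_upwards [self_mem_nhdsWithin] with u hu
      exact hmem u hu _
  · filter_upwards [self_mem_nhdsWithin] with u hu
    exact (fE_eq hq₂ χ₁ χ₂ hψ hu).symm

lemma sum_val_even {q : ℕ} [NeZero q] (hq : 1 < q) {ψ : DirichletCharacter ℂ q} (hψ : ψ ≠ 1)
    (he : ψ (-1) = 1) : ∑ k ∈ range q, ψ (k : ZMod q) * k = 0 := by
  have h1 : ∑ k ∈ range q, ψ (k : ZMod q) * k = ∑ j : ZMod q, ψ j * (j.val : ℂ) := by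
    rw [sum_zmod_eq_range]
    refine sum_congr rfl fun k hk => ?_
    rw [ZMod.val_cast_of_lt (by simpa using hk)]
  have h2 : ∑ j : ZMod q, ψ j * (j.val : ℂ) = ∑ j : ZMod q, ψ j * ((-j).val : ℂ) := by
    refine Fintype.sum_equiv (Equiv.neg _) _ _ fun j => ?_
    rw [Equiv.neg_apply, neg_neg, ← neg_one_mul, map_mul, he, one_mul]
  have h3 : ∑ j : ZMod q, ψ j * (j.val : ℂ) + ∑ j : ZMod q, ψ j * ((-j).val : ℂ) = 0 := by
    rw [← sum_add_distrib]
    have : ∀ j : ZMod q, ψ j * (j.val : ℂ) + ψ j * ((-j).val : ℂ) = ψ j * q := by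
      intro j
      rcases eq_or_ne j 0 with rfl | hj
      · simp [char_zero hq]
      · have : NeZero j := ⟨hj⟩
        rw [ZMod.val_neg_of_ne_zero, Nat.cast_sub (ZMod.val_lt j).le]
        ring
    simp_rw [this]
    rw [← sum_mul, MulChar.sum_eq_zero_of_ne_one hψ, zero_mul]
  rw [← h2] at h3
  rw [h1]
  linear_combination h3 / 2

lemma arg_one_sub_e {x : ℝ} (hx0 : 0 < x) (hx1 : x < 1) :
    Complex.arg (1 - Complex.exp (2 * Real.pi * Complex.I * x)) = Real.pi * (x - 1 / 2) := by
  have hpi := Real.pi_pos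
  have hs : 0 < Real.sin (Real.pi * x) :=
    Real.sin_pos_of_pos_of_lt_pi (by positivity) (by nlinarith)
  have h : 1 - Complex.exp (2 * Real.pi * Complex.I * x) =
      ((2 * Real.sin (Real.pi * x) : ℝ) : ℂ) * (Complex.cos ((Real.pi * (x - 1 / 2) : ℝ) : ℂ)
        + Complex.sin ((Real.pi * (x - 1 / 2) : ℝ) : ℂ) * Complex.I) := by
    rw [← Complex.ofReal_cos, ← Complex.ofReal_sin,
      show Real.pi * (x - 1 / 2) = Real.pi * x - Real.pi / 2 by ring,
      Real.cos_sub_pi_div_two, Real.sin_sub_pi_div_two,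
      show 2 * (Real.pi : ℂ) * Complex.I * x = (2 * (Real.pi * x)) * Complex.I by ring,
      Complex.exp_mul_I, Complex.cos_two_mul, Complex.sin_two_mul]
    push_cast
    have := Complex.sin_sq_add_cos_sq ((Real.pi : ℂ) * x)
    linear_combination (-2) * this
  rw [h, Complex.arg_mul_cos_add_sin_mul_I (by positivity)]
  constructor <;> nlinarith

lemma stdAddChar_eq_exp {q : ℕ} [NeZero q] (a : ZMod q) :
    ZMod.stdAddChar a = Complex.exp (2 * Real.pi * Complex.I * ((a.val / q : ℝ) : ℂ)) := by
  rw [ZMod.stdAddChar_apply]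
  conv_lhs => rw [← ZMod.natCast_zmod_val a]
  rw [ZMod.toCircle_natCast]
  congr 1
  push_cast
  ring

lemma gauss_L1 {q : ℕ} [NeZero q] (hq : 1 < q) {χ : DirichletCharacter ℂ q} (hχ : χ ≠ 1)
    (hprim : χ⁻¹.IsPrimitive) (ho : χ (-1) = -1) :
    gaussSum χ⁻¹ ZMod.stdAddChar * DirichletCharacter.LFunction χ 1 =
      -(Complex.I * Real.pi / q * ∑ k ∈ range q, χ⁻¹ (k : ZMod q) * k) := by
  set ψ := χ⁻¹ with hψdef
  set τ := gaussSum ψ ZMod.stdAddChar with hτ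
  have hψ1 : ψ ≠ 1 := by simpa [hψdef] using hχ
  have hψ0 : ψ 0 = 0 := char_zero hq ψ
  have hoψ : ψ (-1) = -1 := by
    rw [hψdef, MulChar.inv_apply_eq_inv', ho]; norm_num
  have hp : Tendsto (fun n => ∑ i ∈ range n, χ (i : ZMod q) / (i : ℂ)) atTop
      (𝓝 (DirichletCharacter.LFunction χ 1)) := by
    rw [← tendsto_add_atTop_iff_nat 1]
    refine (partial_tendsto_L1 hq hχ).congr fun n => ?_
    rw [sum_range_succ' _ n]
    simp
  have hab := Complex.tendsto_tsum_powerSeries_nhdsWithin_lt hp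
  rw [tendsto_map'_iff] at hab
  have hab2 := hab.const_mul τ
  have hnorm : ∀ a : ZMod q, ‖(ZMod.stdAddChar a : ℂ)‖ = 1 := by
    intro a; rw [ZMod.stdAddChar_apply]; exact Circle.norm_coe _
  have hrew : ∀ᶠ r : ℝ in 𝓝[<] 1, τ * ((fun z : ℂ => ∑' n : ℕ, χ (n : ZMod q) / (n : ℂ) * z ^ n) ∘
      Complex.ofReal) r = ∑ a : ZMod q, ψ a * (-Complex.log (1 - r * ZMod.stdAddChar a)) := by
    have : Set.Ioo (0:ℝ) 1 ∈ 𝓝[<] (1:ℝ) := Ioo_mem_nhdsLT zero_lt_one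
    filter_upwards [this] with r hr
    have hlt : ∀ a : ZMod q, ‖(r : ℂ) * ZMod.stdAddChar a‖ < 1 := by
      intro a
      rw [norm_mul, hnorm, mul_one, Complex.norm_real, Real.norm_of_nonneg hr.1.le]
      exact hr.2
    have hsum : HasSum (fun n : ℕ => ∑ a : ZMod q, ψ a * (((r : ℂ) * ZMod.stdAddChar a) ^ n / n))
        (∑ a : ZMod q, ψ a * (-Complex.log (1 - r * ZMod.stdAddChar a))) :=
      hasSum_sum fun a _ => (Complex.hasSum_taylorSeries_neg_log (hlt a)).mul_left (ψ a)
    rw [← hsum.tsum_eq, Function.comp, ← tsum_mul_left]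
    refine tsum_congr fun n => ?_
    have hg := gaussSum_mulShift_of_isPrimitive ZMod.stdAddChar hprim (n : ZMod q)
    rw [inv_inv, ← hτ, gaussSum] at hg
    have : ∀ a : ZMod q, ψ a * (((r : ℂ) * ZMod.stdAddChar a) ^ n / n) =
        ψ a * ((ZMod.stdAddChar (N := q)).mulShift (n : ZMod q)) a * ((r : ℂ) ^ n / n) := by
      intro a
      rw [AddChar.mulShift_apply, mul_pow, ← AddChar.map_nsmul_eq_pow, nsmul_eq_mul]
      ring
    simp_rw [this]
    rw [← sum_mul, hg]
    ring
  have hre : ∀ a : ZMod q, a ≠ 0 → 1 - (ZMod.stdAddChar a : ℂ) ∈ Complex.slitPlane := by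
    intro a ha
    have hne : (ZMod.stdAddChar a : ℂ) ≠ 1 := by
      intro h
      exact ha (ZMod.injective_stdAddChar (h.trans (AddChar.map_zero_eq_one _).symm))
    have hle : (ZMod.stdAddChar a : ℂ).re ≤ 1 := by
      have := Complex.re_le_norm (ZMod.stdAddChar a : ℂ)
      rwa [hnorm] at this
    left
    rw [Complex.sub_re, Complex.one_re, sub_pos]
    refine lt_of_le_of_ne hle fun h => hne ?_
    have h2 := Complex.normSq_eq_norm_sq (ZMod.stdAddChar a : ℂ)
    rw [hnorm, Complex.normSq_apply, h] at h2
    have him : (ZMod.stdAddChar a : ℂ).im = 0 := by nlinarith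
    exact Complex.ext (by simpa using h) (by simpa using him)
  have hlim : Tendsto (fun r : ℝ => ∑ a : ZMod q, ψ a *
      (-Complex.log (1 - r * ZMod.stdAddChar a))) (𝓝[<] 1)
      (𝓝 (∑ a : ZMod q, ψ a * (-Complex.log (1 - ZMod.stdAddChar a)))) := by
    refine tendsto_finsetSum _ fun a _ => ?_
    rcases eq_or_ne a 0 with rfl | ha
    · simp [hψ0]
    · refine Tendsto.const_mul _ (Tendsto.neg ?_)
      have hc : ContinuousAt (fun r : ℝ => Complex.log (1 - r * ZMod.stdAddChar a)) 1 := by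
        refine ContinuousAt.clog (by fun_prop) ?_
        simpa using hre a ha
      have := hc.tendsto.mono_left (nhdsWithin_le_nhds (s := Set.Iio 1))
      simpa using this
  have heq := tendsto_nhds_unique (hab2.congr' hrew) hlim
  rw [heq]
  have hlog : ∀ a : ZMod q, ψ a * (-Complex.log (1 - ZMod.stdAddChar a)) =
      -(ψ a * (Real.log ‖1 - (ZMod.stdAddChar a : ℂ)‖ : ℂ))
        - Complex.I * Real.pi / q * (ψ a * a.val) + Complex.I * Real.pi / 2 * ψ a := by
    intro a
    rcases eq_or_ne a 0 with rfl | ha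
    · simp [hψ0]
    · have hq0 : (0:ℝ) < q := by positivity
      have h0 : 0 < a.val := Nat.pos_of_ne_zero (by simpa using ha)
      have h1 : a.val < q := ZMod.val_lt a
      have harg := arg_one_sub_e (x := (a.val / q : ℝ)) (by positivity)
        ((div_lt_one hq0).2 (by exact_mod_cast h1))
      rw [← stdAddChar_eq_exp] at harg
      rw [Complex.log, harg]
      push_cast
      ring
  simp_rw [hlog]
  rw [sum_add_distrib, sum_sub_distrib, ← mul_sum, ← mul_sum,
    MulChar.sum_eq_zero_of_ne_one hψ1, sum_neg_distrib]
  have hzero : ∑ a : ZMod q, ψ a * (Real.log ‖1 - (ZMod.stdAddChar a : ℂ)‖ : ℂ) = 0 := by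
    have hneg : ∑ a : ZMod q, ψ a * (Real.log ‖1 - (ZMod.stdAddChar a : ℂ)‖ : ℂ) =
        ∑ a : ZMod q, -(ψ a * (Real.log ‖1 - (ZMod.stdAddChar a : ℂ)‖ : ℂ)) := by
      refine Fintype.sum_equiv (Equiv.neg _) _ _ fun a => ?_
      have hn : ‖1 - (ZMod.stdAddChar (-a) : ℂ)‖ = ‖1 - (ZMod.stdAddChar a : ℂ)‖ := by
        rw [AddChar.map_neg_eq_inv]
        have hne : (ZMod.stdAddChar a : ℂ) ≠ 0 := by
          rw [← norm_pos_iff, hnorm]; exact one_pos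
        have : 1 - (ZMod.stdAddChar a : ℂ)⁻¹ =
            -(1 - (ZMod.stdAddChar a : ℂ)) * (ZMod.stdAddChar a : ℂ)⁻¹ := by
          field_simp; ring
        rw [this, norm_mul, norm_neg, norm_inv, hnorm]; simp
      rw [Equiv.neg_apply, hn, ← neg_one_mul a, map_mul, hoψ]
      ring
    rw [sum_neg_distrib] at hneg
    linear_combination hneg / 2
  have h1 : ∑ k ∈ range q, ψ (k : ZMod q) * k = ∑ j : ZMod q, ψ j * (j.val : ℂ) := by
    rw [sum_zmod_eq_range]
    refine sum_congr rfl fun k hk => ?_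
    rw [ZMod.val_cast_of_lt (by simpa using hk)]
  rw [hzero, h1]
  ring


theorem f_limit_at_zero_parity
    {q₁ q₂ : ℕ} [NeZero q₁] [NeZero q₂] (hq₁ : 1 < q₁) (hq₂ : 1 < q₂)
    (χ₁ : DirichletCharacter ℂ q₁) (χ₂ : DirichletCharacter ℂ q₂)
    (hχ₁ : χ₁.IsPrimitive) (hχ₂ : χ₂.IsPrimitive)
    (hpar : χ₁ (-1) * χ₂ (-1) = 1) :
    (χ₁ (-1) = 1 → χ₂ (-1) = 1 →
      Filter.Tendsto (fun u : ℝ => fE χ₁ χ₂ (Complex.I * (u : ℂ)))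
        (nhdsWithin 0 (Set.Ioi 0)) (nhds 0)) ∧
    (χ₁ (-1) = -1 → χ₂ (-1) = -1 →
      Filter.Tendsto (fun u : ℝ => fE χ₁ χ₂ (Complex.I * (u : ℂ)))
        (nhdsWithin 0 (Set.Ioi 0))
        (nhds (gaussSum' (χ₂.ringHomComp (starRingEnd ℂ)) / (Real.pi * Complex.I) *
          DirichletCharacter.LFunction χ₁ 1 * DirichletCharacter.LFunction χ₂ 1))) := by
  have hne : ∀ {q : ℕ}, 1 < q → ∀ χ : DirichletCharacter ℂ q, χ.IsPrimitive → χ ≠ 1 := by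
    intro q hq χ hχ h
    have : NeZero q := ⟨by omega⟩
    have : χ.conductor = q := hχ
    rw [h, DirichletCharacter.conductor_one] at this
    omega
  have h1 := hne hq₁ χ₁ hχ₁
  have h2 := hne hq₂ χ₂ hχ₂
  have h2i : χ₂⁻¹ ≠ 1 := by simpa using h2
  have hprim : χ₂⁻¹.IsPrimitive := by
    rw [DirichletCharacter.isPrimitive_def, DirichletCharacter.conductor_inv]
    exact hχ₂
  have lim := fE_tendsto hq₁ hq₂ h1 h2i
  refine ⟨fun _ he => ?_, fun _ ho => ?_⟩
  · have hei : χ₂⁻¹ (-1) = 1 := by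
      rw [MulChar.inv_apply_eq_inv', he]; norm_num
    rw [hfun_one, sum_val_even hq₂ h2i hei] at lim
    simpa using lim
  · have hg : gaussSum' (χ₂.ringHomComp (starRingEnd ℂ)) = gaussSum χ₂⁻¹ ZMod.stdAddChar := by
      rw [gaussSum', gaussSum, sum_zmod_eq_range]
      refine sum_congr rfl fun n _ => ?_
      rw [MulChar.ringHomComp_apply, ← MulChar.star_apply', ZMod.stdAddChar_apply,
        ZMod.toCircle_natCast, eC]
      congr 2
      ring
    have hk := gauss_L1 hq₂ h2 hprim ho
    have hq0 : (q₂ : ℂ) ≠ 0 := by exact_mod_cast NeZero.ne q₂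
    have hpi : (Real.pi : ℂ) ≠ 0 := by exact_mod_cast Real.pi_ne_zero
    convert lim using 2
    rw [hg, hfun_one]
    have hk2 : gaussSum χ₂⁻¹ ZMod.stdAddChar / (Real.pi * Complex.I) *
        DirichletCharacter.LFunction χ₂ 1 = 
        -(∑ k ∈ range q₂, χ₂⁻¹ (k : ZMod q₂) * k) / q₂ := by
      rw [div_mul_eq_mul_div, hk]
      field_simp
    rw [← hk2]
    ring
end
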